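/- There exists a universal constant C > 0 (independent of ε) such that for every ε > 0, every choice of sign ±, and every Schwartz function g on ℝ³, the function u(t,x) = ∫_{ℝ³} exp(i x·ξ ± i (t/ε) ξ₃/|ξ|) ĝ(ξ) dξ satisfies ‖u‖_{L⁶(ℝ_t × ℝ³_x)} ≤ C ε^{1/6} ‖g‖_{Ḣ¹}. -/

import Mathlib

open MeasureTheory Complex
open scoped ENNReal RealInnerProductSpace

noncomputable section

/-- Fourier transform `f̂(ξ) = ∫ e^{-i x·ξ} f(x) dx` on `ℝⁿ`. -/
def fourierTf {n : ℕ} (f : EuclideanSpace ℝ (Fin n) → ℂ) (ξ : EuclideanSpace ℝ (Fin n)) : ℂ :=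
  ∫ x : EuclideanSpace ℝ (Fin n), Complex.exp (-Complex.I * Complex.ofReal ⟪x, ξ⟫) * f x

/-- Homogeneous Sobolev norm `‖f‖_{Ḣˢ}` on `ℝⁿ`. -/
def sobolevNorm {n : ℕ} (s : ℝ) (f : EuclideanSpace ℝ (Fin n) → ℂ) : ℝ :=
  (∫ ξ : EuclideanSpace ℝ (Fin n), ‖ξ‖ ^ (2 * s) * ‖fourierTf f ξ‖ ^ 2) ^ (1 / 2 : ℝ)

/-- The rotation dispersion relation `ξ₃ / |ξ|`. -/
def pRot (ξ : EuclideanSpace ℝ (Fin 3)) : ℝ :=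
  ξ 2 / ‖ξ‖

open FourierTransform in
lemma rs_fourier_ae_eq {w : EuclideanSpace ℝ (Fin 3) → ℂ} (hw1 : Integrable w)
    (hw2 : MemLp w 2) :
    (𝓕 w) =ᵐ[volume] (𝓕 (hw2.toLp w) : Lp ℂ 2 (volume : Measure (EuclideanSpace ℝ (Fin 3)))) := by
  apply ae_eq_of_integral_contDiff_smul_eq
  · apply Continuous.locallyIntegrable
    exact VectorFourier.fourierIntegral_continuous Real.continuous_fourierChar
      (by exact continuous_inner) hw1
  · exact (Lp.memLp _).locallyIntegrable (by norm_num)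
  · intro g hg1 hg2
    have hc1 : HasCompactSupport (fun x => (g x : ℂ)) := hg2.comp_left (g := fun r : ℝ => (r : ℂ)) (by simp)
    have hc2 : ContDiff ℝ (⊤ : ℕ∞) (fun x => (g x : ℂ)) := Complex.ofRealCLM.contDiff.comp hg1
    let G := hc1.toSchwartzMap hc2
    have hG : ∀ x, G x = (g x : ℂ) := fun x => rfl
    have h1 := MeasureTheory.Lp.fourier_toTemperedDistribution_eq (hw2.toLp w)
    have h2 := congrArg (fun T => T G) h1
    simp only [TemperedDistribution.fourier_apply, Lp.toTemperedDistribution_apply] at h2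
    have h3 : ∫ x, g x • (𝓕 (hw2.toLp w) : Lp ℂ 2 (volume : Measure (EuclideanSpace ℝ (Fin 3)))) x = ∫ x, (𝓕 G) x • w x := by
      trans ∫ x, G x • (𝓕 (hw2.toLp w) : Lp ℂ 2 (volume : Measure (EuclideanSpace ℝ (Fin 3)))) x
      · apply integral_congr_ae
        filter_upwards with x
        simp [hG]
      · rw [← h2]
        apply integral_congr_ae
        filter_upwards [hw2.coeFn_toLp] with x hx
        rw [hx]
    rw [h3]
    have h4 := VectorFourier.integral_fourierIntegral_smul_eq_flip (μ := volume) (ν := volume)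
      (f := w) (g := G) (L := innerₗ (EuclideanSpace ℝ (Fin 3))) Real.continuous_fourierChar
      (by exact continuous_inner) hw1 G.integrable
    rw [flip_innerₗ] at h4
    trans ∫ x, (𝓕 w) x • G x
    · apply integral_congr_ae
      filter_upwards with x
      simp [hG, mul_comm]
    · refine Eq.trans h4 ?_
      apply integral_congr_ae
      filter_upwards with x
      simp only [smul_eq_mul, mul_comm]
      rfl

open FourierTransform in
lemma rs_plancherel {w : EuclideanSpace ℝ (Fin 3) → ℂ} (hw1 : Integrable w)
    (hw2 : MemLp w 2) :
    ∫⁻ x, ‖∫ ξ : EuclideanSpace ℝ (Fin 3), Complex.exp (Complex.I * Complex.ofReal ⟪x, ξ⟫) * w ξ‖ₑ ^ 2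
      = ENNReal.ofReal ((2 * Real.pi) ^ 3) * ∫⁻ ξ, ‖w ξ‖ₑ ^ 2 := by
  have hpi := Real.pi_pos
  have h0 : ∫⁻ x, ‖(𝓕 w) x‖ₑ ^ 2 = ∫⁻ ξ, ‖w ξ‖ₑ ^ 2 := by
    have h1 : eLpNorm (𝓕 w) 2 = eLpNorm w 2 := by
      rw [eLpNorm_congr_ae (rs_fourier_ae_eq hw1 hw2), ← eLpNorm_congr_ae hw2.coeFn_toLp]
      have := Lp.norm_fourier_eq (hw2.toLp w)
      rw [Lp.norm_def, Lp.norm_def, ENNReal.toReal_eq_toReal_iff' (Lp.eLpNorm_ne_top _) (Lp.eLpNorm_ne_top _)] at this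
      exact this
    rw [eLpNorm_eq_lintegral_rpow_enorm_toReal (by norm_num) (by norm_num),
      eLpNorm_eq_lintegral_rpow_enorm_toReal (by norm_num) (by norm_num)] at h1
    simp only [ENNReal.toReal_ofNat, ENNReal.rpow_ofNat] at h1
    exact (ENNReal.rpow_left_injective (x := 1 / 2) (by norm_num)) h1
  have h2 : ∀ x : EuclideanSpace ℝ (Fin 3),
      ∫ ξ : EuclideanSpace ℝ (Fin 3), Complex.exp (Complex.I * Complex.ofReal ⟪x, ξ⟫) * w ξ
        = (𝓕 w) ((-(2 * Real.pi)⁻¹) • x) := by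
    intro x
    rw [Real.fourier_eq']
    congr 1
    ext ξ
    rw [smul_eq_mul, inner_smul_right, real_inner_comm]
    congr 2
    push_cast
    field_simp
  simp_rw [h2]
  have h3 := MeasureTheory.Measure.map_addHaar_smul (volume : Measure (EuclideanSpace ℝ (Fin 3)))
    (r := -(2 * Real.pi)⁻¹) (by simp [hpi.ne'])
  have hcont : Continuous (𝓕 w) := VectorFourier.fourierIntegral_continuous Real.continuous_fourierChar
      (by exact continuous_inner) hw1
  have h4 : ∫⁻ x, ‖(𝓕 w) ((-(2 * Real.pi)⁻¹) • x)‖ₑ ^ 2 = ∫⁻ y, ‖(𝓕 w) y‖ₑ ^ 2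
      ∂(Measure.map ((-(2 * Real.pi)⁻¹) • ·) (volume : Measure (EuclideanSpace ℝ (Fin 3)))) := by
    rw [lintegral_map (by fun_prop) (by fun_prop)]
  rw [h4, h3, lintegral_smul_measure, h0, smul_eq_mul]
  congr 2
  rw [finrank_euclideanSpace_fin, abs_inv, abs_pow, abs_neg, abs_inv, abs_of_pos (by positivity)]
  rw [inv_pow, inv_inv]

abbrev RS3 := EuclideanSpace ℝ (Fin 3)

lemma rs_polar {f : RS3 → ℂ} (hf : Integrable f) :
    ∫ ξ, f ξ = ∫ ρ in Set.Ioi (0:ℝ), (ρ ^ 2 : ℝ) •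
      ∫ ω : Metric.sphere (0 : RS3) 1, f (ρ • (ω : RS3)) ∂(volume : Measure RS3).toSphere := by
  have hmp := (volume : Measure RS3).measurePreserving_homeomorphUnitSphereProd
  have hdim : Module.finrank ℝ RS3 - 1 = 2 := by simp
  rw [hdim] at hmp
  let g : Metric.sphere (0 : RS3) 1 × Set.Ioi (0:ℝ) → ℂ := fun p => f ((p.2 : ℝ) • (p.1 : RS3))
  have hg : ∀ x : ({0}ᶜ : Set RS3), g (homeomorphUnitSphereProd RS3 x) = f x := by
    rintro ⟨x, hx⟩
    have hx' : x ≠ 0 := hx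
    simp only [g]
    congr 1
    simp [smul_smul, hx']
  have hInt : Integrable g ((volume : Measure RS3).toSphere.prod (Measure.volumeIoiPow 2)) := by
    rw [← hmp.integrable_comp_emb (Homeomorph.measurableEmbedding _)]
    have : g ∘ (homeomorphUnitSphereProd RS3) = f ∘ Subtype.val := by
      ext x; exact hg x
    rw [this, ← integrableOn_iff_comap_subtypeVal (by measurability)]
    exact hf.integrableOn
  calc ∫ ξ, f ξ = ∫ x : ({0}ᶜ : Set RS3), f x ∂((volume : Measure RS3).comap (↑)) := by
        rw [integral_subtype_comap (measurableSet_singleton _).compl f,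
          restrict_compl_singleton]
    _ = ∫ p, g p ∂((volume : Measure RS3).toSphere.prod (Measure.volumeIoiPow 2)) := by
        rw [← hmp.integral_comp (Homeomorph.measurableEmbedding _)]
        simp_rw [hg]
    _ = ∫ ρ : Set.Ioi (0:ℝ), ∫ ω, g (ω, ρ) ∂(volume : Measure RS3).toSphere ∂(Measure.volumeIoiPow 2) := by
        rw [integral_prod_symm _ hInt]
    _ = _ := by
        simp only [Measure.volumeIoiPow, ENNReal.ofReal, g]
        rw [integral_withDensity_eq_integral_smul,
          integral_subtype_comap measurableSet_Ioi fun a : ℝ ↦ Real.toNNReal (a ^ 2) •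
            ∫ ω : Metric.sphere (0 : RS3) 1, f (a • (ω : RS3)) ∂(volume : Measure RS3).toSphere,
          setIntegral_congr_fun measurableSet_Ioi fun x hx ↦ ?_]
        · rw [NNReal.smul_def, Real.coe_toNNReal _ (by positivity)]
        · exact (measurable_subtype_coe.pow_const _).real_toNNReal

/-- The Fourier transform of the surface measure of the unit sphere. -/
def rsI (v : RS3) : ℂ :=
  ∫ ω : Metric.sphere (0 : RS3) 1, Complex.exp (Complex.I * Complex.ofReal ⟪v, (ω : RS3)⟫)
    ∂(volume : Measure RS3).toSphere

lemma rs_ball_exp_integrable (v : RS3) : Integrable (fun ξ : RS3 =>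
    (Metric.ball (0:RS3) 1).indicator (fun ξ =>
      Complex.exp (Complex.I * Complex.ofReal (⟪v, ξ⟫ / ‖ξ‖))) ξ) := by
  rw [integrable_indicator_iff Metric.isOpen_ball.measurableSet]
  apply Measure.integrableOn_of_bounded (M := 1) (by exact measure_ball_lt_top.ne)
  · apply Measurable.aestronglyMeasurable; fun_prop
  · filter_upwards with ξ
    rw [mul_comm, Complex.norm_exp_ofReal_mul_I]

lemma rs_ball_exp (v : RS3) : ∫ ξ : RS3, (Metric.ball (0:RS3) 1).indicator (fun ξ =>
      Complex.exp (Complex.I * Complex.ofReal (⟪v, ξ⟫ / ‖ξ‖))) ξ = (1/3 : ℝ) • rsI v := by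
  rw [rs_polar (rs_ball_exp_integrable v)]
  have : ∀ ρ ∈ Set.Ioi (0:ℝ), (ρ ^ 2 : ℝ) •
      ∫ ω : Metric.sphere (0 : RS3) 1, (Metric.ball (0:RS3) 1).indicator (fun ξ =>
      Complex.exp (Complex.I * Complex.ofReal (⟪v, ξ⟫ / ‖ξ‖))) (ρ • (ω : RS3)) ∂(volume : Measure RS3).toSphere
      = (Set.Ioo (0:ℝ) 1).indicator (fun ρ => (ρ ^ 2 : ℝ) • rsI v) ρ := by
    intro ρ hρ
    have hρ : 0 < ρ := hρ
    by_cases h1 : ρ < 1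
    · rw [Set.indicator_of_mem (show ρ ∈ Set.Ioo (0:ℝ) 1 from ⟨hρ, h1⟩)]
      congr 1
      unfold rsI
      congr 1
      ext ω
      have hω : ‖(ω : RS3)‖ = 1 := by simp
      rw [Set.indicator_of_mem (by simp [norm_smul, abs_of_pos hρ, h1])]
      rw [norm_smul, inner_smul_right, hω, Real.norm_eq_abs, abs_of_pos hρ, mul_one, mul_div_cancel_left₀ _ hρ.ne']
    · rw [Set.indicator_of_notMem (fun h : ρ ∈ Set.Ioo (0:ℝ) 1 => h1 h.2)]
      rw [integral_eq_zero_of_ae, smul_zero]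
      filter_upwards with ω
      rw [Set.indicator_of_notMem]
      · rfl
      · simp [norm_smul, abs_of_pos hρ]; linarith
  rw [setIntegral_congr_fun measurableSet_Ioi this, setIntegral_indicator measurableSet_Ioo]
  have : Set.Ioi (0:ℝ) ∩ Set.Ioo 0 1 = Set.Ioo 0 1 := by
    ext x; simp
  rw [this, integral_smul_const, ← integral_Ioc_eq_integral_Ioo, ← intervalIntegral.integral_of_le (by norm_num)]
  norm_num

/-- The profile in the half plane. -/
def rsH (s z r : ℝ) : ℂ :=
  if z ^ 2 + r ^ 2 < 1 then Complex.exp (Complex.I * Complex.ofReal (s * z / √(z ^ 2 + r ^ 2))) else 0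

lemma rsH_meas (s : ℝ) {α : Type*} [MeasurableSpace α] {f g : α → ℝ} (hf : Measurable f) (hg : Measurable g) :
    Measurable (fun a => rsH s (f a) (g a)) := by
  unfold rsH
  apply Measurable.ite
  · exact measurableSet_lt (by fun_prop) (by fun_prop)
  · fun_prop
  · fun_prop

lemma rsH_norm_le (s z r : ℝ) : ‖rsH s z r‖ ≤ 1 := by
  unfold rsH
  split_ifs
  · rw [mul_comm, Complex.norm_exp_ofReal_mul_I]
  · simp

/-- The one dimensional integral that computes the Fourier transform of the sphere. -/
def rsJ (s : ℝ) : ℂ := ∫ α in Set.Ioo (0:ℝ) Real.pi,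
    (Real.sin α : ℂ) * Complex.exp (Complex.I * Complex.ofReal (s * Real.cos α))

lemma rs_J_le (s : ℝ) : ‖rsJ s‖ ≤ 2 ∧ |s| * ‖rsJ s‖ ≤ 2 := by
  unfold rsJ
  rw [← integral_Ioc_eq_integral_Ioo, ← intervalIntegral.integral_of_le Real.pi_pos.le]
  constructor
  · calc _ ≤ ∫ α in (0:ℝ)..Real.pi, Real.sin α := by
          apply intervalIntegral.norm_integral_le_of_norm_le Real.pi_pos.le
          · filter_upwards with α hα
            rw [norm_mul, mul_comm I, Complex.norm_exp_ofReal_mul_I, mul_one, Complex.norm_real,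
              Real.norm_eq_abs, abs_of_nonneg (Real.sin_nonneg_of_nonneg_of_le_pi hα.1.le hα.2)]
          · exact Real.continuous_sin.intervalIntegrable _ _
      _ = 2 := by rw [integral_sin]; simp; norm_num
  · rcases eq_or_ne s 0 with rfl | hs
    · simp
    · have hsC : (s : ℂ) ≠ 0 := by exact_mod_cast hs
      have hd : ∀ α ∈ Set.uIcc 0 Real.pi, HasDerivAt (fun α : ℝ => -(I * s)⁻¹ *
          Complex.exp (Complex.I * Complex.ofReal (s * Real.cos α)))
          ((Real.sin α : ℂ) * Complex.exp (Complex.I * Complex.ofReal (s * Real.cos α))) α := by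
        intro α _
        have h1 : HasDerivAt (fun α : ℝ => Complex.ofReal (s * Real.cos α)) (Complex.ofReal (s * (-Real.sin α))) α :=
          ((Real.hasDerivAt_cos α).const_mul s).ofReal_comp
        have h2 := ((h1.const_mul Complex.I).cexp).const_mul (-(I * s)⁻¹)
        convert! h2 using 1
        push_cast
        field_simp
      rw [intervalIntegral.integral_eq_sub_of_hasDerivAt hd]
      · refine (mul_le_mul_of_nonneg_left (norm_sub_le _ _) (abs_nonneg s)).trans ?_
        simp only [norm_mul, norm_neg, norm_inv, mul_comm I, Complex.norm_exp_ofReal_mul_I]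
        simp
        apply le_of_eq
        have := abs_pos.2 hs
        field_simp
        norm_num
      · apply Continuous.intervalIntegrable; fun_prop


/-- Splitting off the third coordinate. -/
lemma rs_split (F : ℝ × ℝ × ℝ → ℂ) :
    ∫ ξ : RS3, F (ξ 2, ξ 0, ξ 1) = ∫ p : ℝ × ℝ × ℝ, F p := by
  have h1 := EuclideanSpace.volume_preserving_symm_measurableEquiv_toLp (Fin 3)
  have h2 := volume_preserving_piFinSuccAbove (fun _ : Fin 3 => ℝ) 2
  have h3 := volume_preserving_finTwoArrow ℝ
  have h4 := (MeasurePreserving.id (volume : Measure ℝ)).prod h3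
  have h5 := h4.comp (h2.comp h1)
  have he : MeasurableEmbedding (Prod.map id (MeasurableEquiv.finTwoArrow (α := ℝ)) ∘
    (MeasurableEquiv.piFinSuccAbove (fun _ : Fin 3 => ℝ) 2) ∘ (MeasurableEquiv.toLp 2 (Fin 3 → ℝ)).symm) := by
    refine MeasurableEmbedding.comp ?_ ((MeasurableEquiv.measurableEmbedding _).comp (MeasurableEquiv.measurableEmbedding _))
    exact MeasurableEmbedding.id.prodMap (MeasurableEquiv.measurableEmbedding _)
  have h6 := h5.integral_comp he F
  exact h6

lemma rs_inner_polar (s z : ℝ) : ∫ p : ℝ × ℝ, rsH s z √(p.1 ^ 2 + p.2 ^ 2) =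
    (2 * Real.pi) • ∫ r in Set.Ioi (0:ℝ), r • rsH s z r := by
  rw [← integral_comp_polarCoord_symm]
  have h1 : ∀ p ∈ polarCoord.target, p.1 • rsH s z √((polarCoord.symm p).1 ^ 2 + (polarCoord.symm p).2 ^ 2)
      = (fun r : ℝ => r • rsH s z r) p.1 := by
    rintro ⟨r, θ⟩ hp
    have hr : 0 < r := hp.1
    simp only [polarCoord_symm_apply]
    have : (r * Real.cos θ) ^ 2 + (r * Real.sin θ) ^ 2 = r ^ 2 := by
      have := Real.sin_sq_add_cos_sq θ
      linear_combination r ^ 2 * this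
    rw [this, Real.sqrt_sq hr.le]
  rw [setIntegral_congr_fun polarCoord.open_target.measurableSet h1]
  rw [polarCoord_target, Measure.volume_eq_prod, ← Measure.prod_restrict, integral_fun_fst (fun r : ℝ => r • rsH s z r)]
  congr 1
  simp [Real.pi_pos.le]
  ring

lemma rsH_eq_zero {s z r : ℝ} (h : 1 ≤ z ^ 2 + r ^ 2) : rsH s z r = 0 := by
  unfold rsH; rw [if_neg (not_lt.2 h)]

lemma rs_int_aux {F : ℝ × ℝ → ℂ} (hm : Measurable F) (hb : ∀ p, ‖F p‖ ≤ 1)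
    (h0 : ∀ p : ℝ × ℝ, 1 ≤ p.1 ^ 2 + p.2 ^ 2 → F p = 0) : Integrable F := by
  have : F = (Set.Icc (-1:ℝ) 1 ×ˢ Set.Icc (-1:ℝ) 1).indicator F := by
    ext p
    symm
    by_cases hp : p ∈ (Set.Icc (-1:ℝ) 1 ×ˢ Set.Icc (-1:ℝ) 1)
    · rw [Set.indicator_of_mem hp]
    · rw [Set.indicator_of_notMem hp]
      symm
      apply h0
      by_contra hlt
      push Not at hlt
      apply hp
      refine ⟨?_, ?_⟩ <;> exact abs_le.1 (abs_le_of_sq_le_sq (by nlinarith [sq_nonneg p.1, sq_nonneg p.2]) zero_le_one)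
  rw [this, integrable_indicator_iff (measurableSet_Icc.prod measurableSet_Icc)]
  apply Measure.integrableOn_of_bounded (M := 1)
  · exact ((isCompact_Icc.prod isCompact_Icc).measure_lt_top).ne
  · exact hm.aestronglyMeasurable
  · filter_upwards with p using hb p

/-- weighted profile on the half plane -/
def rsHw (s : ℝ) (p : ℝ × ℝ) : ℂ := if 0 < p.2 then p.2 • rsH s p.1 p.2 else 0

lemma rs_outer_polar (s : ℝ) : ∫ p : ℝ × ℝ, rsHw s p = (1 / 3 : ℝ) • rsJ s := by
  rw [← integral_comp_polarCoord_symm]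
  have h1 : ∀ p ∈ polarCoord.target, p.1 • rsHw s (polarCoord.symm p)
      = (Set.Ioo (0:ℝ) 1).indicator (fun ρ : ℝ => (ρ ^ 2 : ℂ)) p.1 * (Set.Ioo (0:ℝ) Real.pi).indicator
        (fun α => (Real.sin α : ℂ) * Complex.exp (Complex.I * Complex.ofReal (s * Real.cos α))) p.2 := by
    rintro ⟨r, θ⟩ hp
    have hr : 0 < r := hp.1
    have hθ : -Real.pi < θ ∧ θ < Real.pi := hp.2
    simp only [polarCoord_symm_apply, rsHw]
    have : (r * Real.cos θ) ^ 2 + (r * Real.sin θ) ^ 2 = r ^ 2 := by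
      have := Real.sin_sq_add_cos_sq θ
      linear_combination r ^ 2 * this
    by_cases hθ0 : 0 < θ
    · have hs := Real.sin_pos_of_pos_of_lt_pi hθ0 hθ.2
      rw [if_pos (by positivity), Set.indicator_of_mem (show θ ∈ Set.Ioo 0 Real.pi from ⟨hθ0, hθ.2⟩)]
      unfold rsH
      rw [this, Real.sqrt_sq hr.le]
      by_cases hr1 : r < 1
      · rw [if_pos (by nlinarith), Set.indicator_of_mem (show r ∈ Set.Ioo (0:ℝ) 1 from ⟨hr, hr1⟩)]
        have : s * (r * Real.cos θ) / r = s * Real.cos θ := by field_simp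
        rw [this]
        simp only [Complex.real_smul]
        push_cast; ring
      · rw [if_neg (by nlinarith), Set.indicator_of_notMem (fun h : r ∈ Set.Ioo (0:ℝ) 1 => hr1 h.2)]
        simp
    · have hs : Real.sin θ ≤ 0 := Real.sin_nonpos_of_nonpos_of_neg_pi_le (not_lt.1 hθ0) hθ.1.le
      rw [if_neg (by nlinarith), Set.indicator_of_notMem (fun h : θ ∈ Set.Ioo (0:ℝ) Real.pi => hθ0 h.1)]
      simp
  rw [setIntegral_congr_fun polarCoord.open_target.measurableSet h1]
  rw [polarCoord_target, Measure.volume_eq_prod, setIntegral_prod_mul,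
    setIntegral_indicator measurableSet_Ioo, setIntegral_indicator measurableSet_Ioo]
  have e1 : Set.Ioi (0:ℝ) ∩ Set.Ioo 0 1 = Set.Ioo 0 1 := by ext x; simp
  have e2 : Set.Ioo (-Real.pi) (Real.pi) ∩ Set.Ioo 0 Real.pi = Set.Ioo 0 Real.pi := by
    ext x
    have := Real.pi_pos
    simp only [Set.mem_inter_iff, Set.mem_Ioo]
    constructor
    · rintro ⟨_, h⟩; exact h
    · rintro h; exact ⟨⟨by linarith, h.2⟩, h⟩
  rw [e1, e2, Complex.real_smul]
  congr 1
  rw [← integral_Ioc_eq_integral_Ioo, ← intervalIntegral.integral_of_le (by norm_num)]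
  have : ∀ x : ℝ, (x : ℂ) ^ 2 = ((x ^ 2 : ℝ) : ℂ) := by intro x; push_cast; rfl
  simp_rw [this, intervalIntegral.integral_ofReal]
  norm_num

lemma rs_ball_e3 (s : ℝ) : ∫ ξ : RS3, (Metric.ball (0:RS3) 1).indicator (fun ξ =>
      Complex.exp (Complex.I * Complex.ofReal (s * ξ 2 / ‖ξ‖))) ξ = (2 * Real.pi / 3) • rsJ s := by
  let G : ℝ × ℝ × ℝ → ℂ := fun p => rsH s p.1 √(p.2.1 ^ 2 + p.2.2 ^ 2)
  have h1 : ∀ ξ : RS3, (Metric.ball (0:RS3) 1).indicator (fun ξ =>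
      Complex.exp (Complex.I * Complex.ofReal (s * ξ 2 / ‖ξ‖))) ξ = G (ξ 2, ξ 0, ξ 1) := by
    intro ξ
    have hn : ξ 2 ^ 2 + √(ξ 0 ^ 2 + ξ 1 ^ 2) ^ 2 = ‖ξ‖ ^ 2 := by
      rw [Real.sq_sqrt (by positivity), EuclideanSpace.norm_sq_eq, Fin.sum_univ_three]
      simp; ring
    simp only [G, rsH]
    rw [hn, Real.sqrt_sq (norm_nonneg _)]
    by_cases h : ‖ξ‖ < 1
    · rw [Set.indicator_of_mem (by simpa using h), if_pos (by nlinarith [norm_nonneg ξ])]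
    · rw [Set.indicator_of_notMem (by simpa using h), if_neg (by nlinarith [norm_nonneg ξ])]
  simp_rw [h1]
  rw [rs_split G]
  have hGm : Measurable G := rsH_meas s (by fun_prop) (by fun_prop)
  have hGi : Integrable G := by
    have : G = (Set.Icc (-1:ℝ) 1 ×ˢ (Set.Icc (-1:ℝ) 1 ×ˢ Set.Icc (-1:ℝ) 1)).indicator G := by
      ext p
      symm
      by_cases hp : p ∈ (Set.Icc (-1:ℝ) 1 ×ˢ (Set.Icc (-1:ℝ) 1 ×ˢ Set.Icc (-1:ℝ) 1))
      · rw [Set.indicator_of_mem hp]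
      · rw [Set.indicator_of_notMem hp]
        symm
        apply rsH_eq_zero
        rw [Real.sq_sqrt (by positivity)]
        by_contra hlt
        push Not at hlt
        apply hp
        refine ⟨?_, ?_, ?_⟩ <;> exact abs_le.1 (abs_le_of_sq_le_sq (by nlinarith [sq_nonneg p.1, sq_nonneg p.2.1, sq_nonneg p.2.2]) zero_le_one)
    rw [this, integrable_indicator_iff (measurableSet_Icc.prod (measurableSet_Icc.prod measurableSet_Icc))]
    apply Measure.integrableOn_of_bounded (M := 1)
    · exact ((isCompact_Icc.prod (isCompact_Icc.prod isCompact_Icc)).measure_lt_top).ne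
    · exact hGm.aestronglyMeasurable
    · filter_upwards with p using rsH_norm_le _ _ _
  rw [Measure.volume_eq_prod, integral_prod _ hGi]
  have h2 : ∀ z : ℝ, ∫ p : ℝ × ℝ, G (z, p) = (2 * Real.pi) • ∫ r, rsHw s (z, r) := by
    intro z
    simp only [G]
    rw [rs_inner_polar, ← integral_indicator measurableSet_Ioi]
    congr 2
  simp_rw [h2]
  have hmw : Measurable (rsHw s) := by
    unfold rsHw
    apply Measurable.ite
    · exact measurableSet_lt measurable_const measurable_snd
    · exact measurable_snd.smul (rsH_meas s measurable_fst measurable_snd)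
    · exact measurable_const
  have hiw : Integrable (rsHw s) := by
    apply rs_int_aux hmw
    · intro p
      unfold rsHw
      split_ifs with h
      · by_cases h1 : p.1 ^ 2 + p.2 ^ 2 < 1
        · rw [norm_smul, Real.norm_eq_abs, abs_of_pos h]
          have : p.2 ≤ 1 := by nlinarith [sq_nonneg p.1]
          exact mul_le_one₀ this (norm_nonneg _) (rsH_norm_le _ _ _)
        · rw [rsH_eq_zero (not_lt.1 h1)]; simp
      · simp
    · intro p hp
      unfold rsHw
      rw [rsH_eq_zero hp]; simp
  rw [integral_smul, ← integral_prod _ hiw, ← Measure.volume_eq_prod, rs_outer_polar, smul_smul]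
  congr 1; ring

lemma rsI_eq (v : RS3) : rsI v = (2 * Real.pi) • rsJ ‖v‖ := by
  have h1 := rs_ball_exp v
  have h2 := rs_ball_e3 ‖v‖
  let e : RS3 := ‖v‖ • EuclideanSpace.single 2 (1:ℝ)
  have he : ‖v‖ = ‖e‖ := by simp [e, norm_smul]
  let U := Submodule.reflection (ℝ ∙ (v - e))ᗮ
  have hU : U v = e := Submodule.reflection_sub he
  have h3 : ∫ ξ : RS3, (Metric.ball (0:RS3) 1).indicator (fun ξ =>
      Complex.exp (Complex.I * Complex.ofReal (⟪v, ξ⟫ / ‖ξ‖))) ξ = ∫ ξ : RS3, (Metric.ball (0:RS3) 1).indicator (fun ξ =>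
      Complex.exp (Complex.I * Complex.ofReal (‖v‖ * ξ 2 / ‖ξ‖))) ξ := by
    symm
    rw [← U.measurePreserving.integral_comp U.toHomeomorph.measurableEmbedding]
    congr 1
    ext ξ
    have e1 : ‖v‖ * (U ξ) 2 = ⟪v, ξ⟫ := by
      rw [← U.inner_map_map v ξ, hU]
      simp [e, inner_smul_left, EuclideanSpace.inner_single_left]
    by_cases h : ‖ξ‖ < 1
    · rw [Set.indicator_of_mem (by simpa using h), Set.indicator_of_mem (by simpa using h), e1, U.norm_map]
    · rw [Set.indicator_of_notMem (by simpa using h), Set.indicator_of_notMem (by simpa using h)]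
  rw [h1, h2] at h3
  have h4 := congrArg (fun z => (3:ℝ) • z) h3
  simp only [smul_smul] at h4
  norm_num at h4
  rw [h4, Complex.real_smul]
  push_cast; ring

lemma rsI_le (v : RS3) : ‖rsI v‖ ≤ 4 * Real.pi ∧ ‖v‖ * ‖rsI v‖ ≤ 4 * Real.pi := by
  have := rs_J_le ‖v‖
  rw [abs_of_nonneg (norm_nonneg v)] at this
  rw [rsI_eq, norm_smul, Real.norm_eq_abs, abs_of_pos (by positivity)]
  have hp := Real.pi_pos
  constructor <;> nlinarith

/-- The unit vector along the rotation axis. -/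
def rsE3 : RS3 := EuclideanSpace.single 2 (1:ℝ)

lemma rsE3_norm : ‖rsE3‖ = 1 := by simp [rsE3]

/-- The phase. -/
def rsPh (t : ℝ) (x ξ : RS3) : ℝ := ⟪x, ξ⟫ + t * pRot ξ

lemma rsPh_meas {α : Type*} [MeasurableSpace α] {f : α → ℝ} {g h : α → RS3} (hf : Measurable f)
    (hg : Measurable g) (hh : Measurable h) : Measurable (fun a => rsPh (f a) (g a) (h a)) := by
  unfold rsPh pRot
  have : Measurable (fun a => (h a) 2) := by fun_prop
  have h2 : Measurable (fun a => ⟪g a, h a⟫) := hg.inner hh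
  fun_prop

lemma rs_inv_sq_integrable (a : ℝ) : IntegrableOn (fun ξ : RS3 => (‖ξ‖ ^ 2)⁻¹) (Metric.ball 0 a) := by
  have := (integrableOn_fun_norm_addHaar (volume : Measure RS3) (f := fun y : ℝ => (y ^ 2)⁻¹) (r := a)).2
  apply this
  have hdim : Module.finrank ℝ RS3 - 1 = 2 := by simp
  rw [hdim]
  refine (integrableOn_const (C := (1:ℝ)) (by simp)).congr_fun ?_ measurableSet_Ioo
  intro y hy
  have : 0 < y := hy.1
  simp only [smul_eq_mul]
  field_simp

/-- The kernel of `T T*`. -/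
def rsK (a t : ℝ) (x : RS3) : ℂ :=
  ∫ ξ in Metric.ball (0:RS3) a, ((‖ξ‖ ^ 2)⁻¹ : ℝ) • Complex.exp (Complex.I * Complex.ofReal (rsPh t x ξ))

lemma rsK_integrable (a t : ℝ) (x : RS3) : IntegrableOn (fun ξ : RS3 =>
    ((‖ξ‖ ^ 2)⁻¹ : ℝ) • Complex.exp (Complex.I * Complex.ofReal (rsPh t x ξ))) (Metric.ball (0:RS3) a) := by
  refine (rs_inv_sq_integrable a).mono' ?_ ?_
  · apply Measurable.aestronglyMeasurable
    have := rsPh_meas (measurable_const (a := t)) (measurable_const (a := x)) measurable_id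
    simp only [id] at this
    fun_prop
  · filter_upwards with ξ
    rw [norm_smul, mul_comm I, Complex.norm_exp_ofReal_mul_I, mul_one, Real.norm_eq_abs, abs_of_nonneg (by positivity)]

lemma rsK_eq (a t : ℝ) (x : RS3) : rsK a t x = ∫ ρ in Set.Ioo (0:ℝ) a, rsI (ρ • x + t • rsE3) := by
  unfold rsK
  rw [← integral_indicator Metric.isOpen_ball.measurableSet, rs_polar
    ((integrable_indicator_iff Metric.isOpen_ball.measurableSet).2 (rsK_integrable a t x))]
  have : ∀ ρ ∈ Set.Ioi (0:ℝ), (ρ ^ 2 : ℝ) •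
      ∫ ω : Metric.sphere (0 : RS3) 1, (Metric.ball (0:RS3) a).indicator (fun ξ : RS3 =>
      ((‖ξ‖ ^ 2)⁻¹ : ℝ) • Complex.exp (Complex.I * Complex.ofReal (rsPh t x ξ))) (ρ • (ω : RS3)) ∂(volume : Measure RS3).toSphere
      = (Set.Ioo (0:ℝ) a).indicator (fun ρ => rsI (ρ • x + t • rsE3)) ρ := by
    intro ρ hρ
    have hρ : 0 < ρ := hρ
    by_cases h1 : ρ < a
    · rw [Set.indicator_of_mem (show ρ ∈ Set.Ioo (0:ℝ) a from ⟨hρ, h1⟩)]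
      unfold rsI
      rw [← integral_smul]
      congr 1
      ext ω
      have hω : ‖(ω : RS3)‖ = 1 := by simp
      rw [Set.indicator_of_mem (by simp [norm_smul, abs_of_pos hρ, h1])]
      rw [norm_smul, hω, Real.norm_eq_abs, abs_of_pos hρ, mul_one, smul_smul, mul_inv_cancel₀ (by positivity), one_smul]
      congr 3
      unfold rsPh pRot
      rw [norm_smul, hω, Real.norm_eq_abs, abs_of_pos hρ, inner_add_left, inner_smul_left, inner_smul_left, inner_smul_right]
      simp [rsE3, EuclideanSpace.inner_single_left]
      field_simp
      simp
    · rw [Set.indicator_of_notMem (fun h : ρ ∈ Set.Ioo (0:ℝ) a => h1 h.2)]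
      rw [integral_eq_zero_of_ae, smul_zero]
      filter_upwards with ω
      rw [Set.indicator_of_notMem]
      · rfl
      · simp [norm_smul, abs_of_pos hρ]; linarith
  rw [setIntegral_congr_fun measurableSet_Ioi this, setIntegral_indicator measurableSet_Ioo]
  have : Set.Ioi (0:ℝ) ∩ Set.Ioo 0 a = Set.Ioo 0 a := by
    ext x; simp +contextual
  rw [this]

lemma rsI_le_rpow (v : RS3) {d : ℝ} (hd : 0 < d) (hv : d ≤ ‖v‖) : ‖rsI v‖ ≤ 4 * Real.pi * d ^ (-(3/4) : ℝ) := by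
  obtain ⟨h1, h2⟩ := rsI_le v
  have hp := Real.pi_pos
  rcases le_or_gt d 1 with h | h
  · have : 1 ≤ d ^ (-(3/4) : ℝ) := Real.one_le_rpow_of_pos_of_le_one_of_nonpos hd h (by norm_num)
    nlinarith
  · have : d ^ (-1 : ℝ) ≤ d ^ (-(3/4) : ℝ) := Real.rpow_le_rpow_of_exponent_le h.le (by norm_num)
    rw [Real.rpow_neg_one] at this
    have h3 : ‖rsI v‖ ≤ 4 * Real.pi * d⁻¹ := by
      rw [← div_eq_mul_inv, le_div_iff₀ hd]
      nlinarith [norm_nonneg (rsI v)]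
    nlinarith

lemma rs_abs_rpow_int (a : ℝ) (ha : 0 < a) : IntegrableOn (fun y : ℝ => |y| ^ (-(3/4) : ℝ)) (Set.Ioc (-a) a) ∧
    ∫ y in Set.Ioc (-a) a, |y| ^ (-(3/4) : ℝ) = 8 * a ^ (1/4 : ℝ) := by
  have i1 : IntegrableOn (fun y : ℝ => |y| ^ (-(3/4) : ℝ)) (Set.Ioc 0 a) := by
    have := (intervalIntegral.intervalIntegrable_rpow' (a := 0) (b := a) (r := (-(3/4) : ℝ)) (by norm_num)).1
    refine this.congr_fun ?_ measurableSet_Ioc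
    intro y hy
    simp only [abs_of_pos hy.1]
  have j1 : ∫ y in Set.Ioc 0 a, |y| ^ (-(3/4) : ℝ) = 4 * a ^ (1/4 : ℝ) := by
    have : ∫ y in Set.Ioc 0 a, |y| ^ (-(3/4) : ℝ) = ∫ y in Set.Ioc 0 a, y ^ (-(3/4) : ℝ) := by
      apply setIntegral_congr_fun measurableSet_Ioc
      intro y hy
      simp only [abs_of_pos hy.1]
    rw [this, ← intervalIntegral.integral_of_le ha.le, integral_rpow (Or.inl (by norm_num))]
    rw [Real.zero_rpow (by norm_num)]
    norm_num
    ring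
  have ii1 : IntervalIntegrable (fun y : ℝ => |y| ^ (-(3/4) : ℝ)) volume 0 a :=
    (intervalIntegrable_iff_integrableOn_Ioc_of_le ha.le).2 i1
  have ii2 : IntervalIntegrable (fun y : ℝ => |y| ^ (-(3/4) : ℝ)) volume (-a) 0 := by
    have := ii1.comp_sub_left 0
    simp only [zero_sub, abs_neg, sub_zero] at this
    exact this.symm
  refine ⟨(intervalIntegrable_iff_integrableOn_Ioc_of_le (by linarith)).1 (ii2.trans ii1), ?_⟩
  rw [← intervalIntegral.integral_of_le (by linarith), ← intervalIntegral.integral_add_adjacent_intervals ii2 ii1]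
  have : ∫ y in (-a)..0, |y| ^ (-(3/4) : ℝ) = ∫ y in (0)..a, |y| ^ (-(3/4) : ℝ) := by
    have := intervalIntegral.integral_comp_neg (a := -a) (b := 0) (fun y : ℝ => |y| ^ (-(3/4) : ℝ))
    simpa using this
  rw [this, intervalIntegral.integral_of_le ha.le, j1]
  ring

lemma rs_shift_int (a c : ℝ) (ha : 0 < a) : IntegrableOn (fun y : ℝ => |y - c| ^ (-(3/4) : ℝ)) (Set.Ioo 0 a) ∧
    ∫ y in Set.Ioo 0 a, |y - c| ^ (-(3/4) : ℝ) ≤ 9 * a ^ (1/4 : ℝ) := by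
  obtain ⟨h1, h2⟩ := rs_abs_rpow_int a ha
  let F : ℝ → ℝ := fun y => (Set.Ioc (-a) a).indicator (fun y : ℝ => |y| ^ (-(3/4) : ℝ)) y
  have hF : Integrable F := (integrable_indicator_iff measurableSet_Ioc).2 h1
  have hFc : Integrable (fun y => F (y - c)) := hF.comp_sub_right c
  have hF0 : ∀ y, 0 ≤ F y := fun y => Set.indicator_nonneg (fun y _ => by positivity) y
  have hk : IntegrableOn (fun y => F (y - c) + a ^ (-(3/4) : ℝ)) (Set.Ioo 0 a) :=
    hFc.integrableOn.add (integrableOn_const (by simp))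
  have hle : ∀ y, |y - c| ^ (-(3/4) : ℝ) ≤ F (y - c) + a ^ (-(3/4) : ℝ) := by
    intro y
    by_cases h : y - c ∈ Set.Ioc (-a) a
    · simp only [F, Set.indicator_of_mem h]
      have : 0 ≤ a ^ (-(3/4) : ℝ) := by positivity
      linarith
    · have : a ≤ |y - c| := by
        by_contra h'
        push Not at h'
        rw [abs_lt] at h'
        exact h ⟨h'.1, h'.2.le⟩
      have := Real.rpow_le_rpow_of_nonpos ha this (show (-(3/4) : ℝ) ≤ 0 by norm_num)
      linarith [hF0 (y - c)]
  have hi : IntegrableOn (fun y : ℝ => |y - c| ^ (-(3/4) : ℝ)) (Set.Ioo 0 a) := by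
    refine hk.mono' (by apply Measurable.aestronglyMeasurable; fun_prop) ?_
    filter_upwards with y
    rw [Real.norm_eq_abs, abs_of_nonneg (by positivity)]
    exact hle y
  refine ⟨hi, ?_⟩
  calc _ ≤ ∫ y in Set.Ioo 0 a, (F (y - c) + a ^ (-(3/4) : ℝ)) := setIntegral_mono hi hk hle
    _ = (∫ y in Set.Ioo 0 a, F (y - c)) + a * a ^ (-(3/4) : ℝ) := by
        rw [integral_add hFc.integrableOn (integrableOn_const (by simp))]
        simp [ha.le]
    _ ≤ (∫ y, F (y - c)) + a * a ^ (-(3/4) : ℝ) := by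
        exact add_le_add (setIntegral_le_integral hFc (by filter_upwards with y using hF0 _)) le_rfl
    _ = 8 * a ^ (1/4 : ℝ) + a ^ (1/4 : ℝ) := by
        rw [integral_sub_right_eq_self F c]
        simp only [F]
        rw [integral_indicator measurableSet_Ioc, h2]
        congr 1
        nth_rewrite 1 [← Real.rpow_one a]
        rw [← Real.rpow_add ha]; norm_num
    _ = _ := by ring

lemma rsK_le_one (a N t : ℝ) (x : RS3) (h0 : 0 ≤ a) (h : a ≤ N) : ‖rsK a t x‖ ≤ 4 * Real.pi * N := by
  rw [rsK_eq]
  have := norm_setIntegral_le_of_norm_le_const (μ := volume) (s := Set.Ioo 0 a) (C := 4 * Real.pi)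
    (f := fun ρ => rsI (ρ • x + t • rsE3)) (by simp) (fun ρ _ => (rsI_le _).1)
  simp [h0] at this
  nlinarith [Real.pi_pos]

lemma rsK_le_rpow (a N t : ℝ) (x : RS3) (h0 : 0 ≤ a) (h : a ≤ N) (ht : t ≠ 0) :
    ‖rsK a t x‖ ≤ 72 * Real.pi * N * |t| ^ (-(3/4) : ℝ) := by
  have hpi := Real.pi_pos
  have htp : 0 < |t| := abs_pos.2 ht
  have htwo : (1/2 : ℝ) ^ (-(3/4) : ℝ) ≤ 2 := by
    rw [one_div, Real.inv_rpow (by norm_num), ← Real.rpow_neg (by norm_num), neg_neg]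
    calc (2:ℝ) ^ (3/4 : ℝ) ≤ 2 ^ (1:ℝ) := Real.rpow_le_rpow_of_exponent_le (by norm_num) (by norm_num)
      _ = 2 := by simp
  have hth : (|t| / 2) ^ (-(3/4) : ℝ) ≤ 2 * |t| ^ (-(3/4) : ℝ) := by
    rw [div_eq_mul_one_div, Real.mul_rpow htp.le (by norm_num), mul_comm]
    gcongr
  have htn : 0 ≤ |t| ^ (-(3/4) : ℝ) := by positivity
  rcases h0.eq_or_lt with rfl | hpos
  · rw [rsK_eq]; simp; positivity
  rw [rsK_eq]
  rcases le_or_gt (a * ‖x‖) (|t| / 2) with hc | hc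
  · have hb : ∀ ρ ∈ Set.Ioo 0 a, ‖rsI (ρ • x + t • rsE3)‖ ≤ 4 * Real.pi * (|t| / 2) ^ (-(3/4) : ℝ) := by
      intro ρ hρ
      apply rsI_le_rpow _ (by positivity)
      have h1 : ‖t • rsE3‖ = |t| := by rw [norm_smul, rsE3_norm]; simp
      have h2 : ‖ρ • x‖ ≤ |t| / 2 := by
        rw [norm_smul, Real.norm_eq_abs, abs_of_pos hρ.1]
        nlinarith [norm_nonneg x, hρ.2]
      have h3 := norm_sub_norm_le (t • rsE3) (-(ρ • x))
      rw [sub_neg_eq_add, norm_neg, add_comm (t • rsE3)] at h3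
      linarith
    have := norm_setIntegral_le_of_norm_le_const (μ := volume) (s := Set.Ioo 0 a) (by simp) hb
    simp [h0] at this
    calc _ ≤ _ := this
      _ ≤ 4 * Real.pi * (2 * |t| ^ (-(3/4) : ℝ)) * N := by gcongr
      _ ≤ _ := by
        have : 0 ≤ Real.pi * N * |t| ^ (-(3/4) : ℝ) := by
          have : 0 ≤ N := by linarith
          positivity
        nlinarith
  · have hx : 0 < ‖x‖ := by
      by_contra h'
      have : ‖x‖ = 0 := le_antisymm (not_lt.1 h') (norm_nonneg _)
      rw [this] at hc; linarith
    let c : ℝ := -(t * ⟪rsE3, x⟫) / ‖x‖ ^ 2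
    obtain ⟨i1, i2⟩ := rs_shift_int a c hpos
    have hb : ∀ ρ : ℝ, ρ ≠ c → ‖rsI (ρ • x + t • rsE3)‖ ≤ 4 * Real.pi * ‖x‖ ^ (-(3/4) : ℝ) * |ρ - c| ^ (-(3/4) : ℝ) := by
      intro ρ hρ
      have hρ' : 0 < |ρ - c| := abs_pos.2 (sub_ne_zero.2 hρ)
      rw [mul_assoc, ← Real.mul_rpow hx.le hρ'.le]
      apply rsI_le_rpow _ (by positivity)
      have h1 : ⟪ρ • x + t • rsE3, x⟫ = ‖x‖ ^ 2 * (ρ - c) := by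
        rw [inner_add_left, inner_smul_left, inner_smul_left, real_inner_self_eq_norm_sq]
        simp only [c, conj_trivial]
        field_simp
        ring
      have h2 := abs_real_inner_le_norm (ρ • x + t • rsE3) x
      rw [h1, abs_mul, abs_of_nonneg (by positivity), pow_two, mul_assoc, mul_comm] at h2
      exact le_of_mul_le_mul_right h2 hx
    calc _ ≤ ∫ ρ in Set.Ioo 0 a, 4 * Real.pi * ‖x‖ ^ (-(3/4) : ℝ) * |ρ - c| ^ (-(3/4) : ℝ) := by
          apply norm_integral_le_of_norm_le (i1.const_mul _)
          apply ae_restrict_of_ae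
          have : ∀ᵐ ρ : ℝ, ρ ≠ c := by simp [ae_iff]
          filter_upwards [this] with ρ hρ using hb ρ hρ
      _ ≤ 4 * Real.pi * ‖x‖ ^ (-(3/4) : ℝ) * (9 * a ^ (1/4 : ℝ)) := by
          rw [integral_const_mul]; gcongr
      _ = 36 * Real.pi * a * (a * ‖x‖) ^ (-(3/4) : ℝ) := by
          rw [Real.mul_rpow hpos.le hx.le]
          have : a ^ (1/4 : ℝ) = a * a ^ (-(3/4) : ℝ) := by
            nth_rewrite 2 [← Real.rpow_one a]
            rw [← Real.rpow_add hpos]; norm_num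
          rw [this]; ring
      _ ≤ 36 * Real.pi * N * (2 * |t| ^ (-(3/4) : ℝ)) := by
          have : (a * ‖x‖) ^ (-(3/4) : ℝ) ≤ (|t| / 2) ^ (-(3/4) : ℝ) :=
            Real.rpow_le_rpow_of_nonpos (by positivity) hc.le (by norm_num)
          have h5 := this.trans hth
          have : 0 ≤ N := by linarith
          gcongr
      _ = _ := by ring

lemma rsK_le (a N t : ℝ) (x : RS3) (h0 : 0 ≤ a) (h : a ≤ N) :
    ‖rsK a t x‖ ≤ 144 * Real.pi * N * (1 + |t|) ^ (-(3/4) : ℝ) := by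
  have hpi := Real.pi_pos
  have hN : 0 ≤ N := h0.trans h
  have key : ∀ s : ℝ, 0 < s → s ≤ 2 * s → (2 * s) ^ (-(3/4) : ℝ) ≥ s ^ (-(3/4) : ℝ) / 2 := by
    intro s hs _
    rw [Real.mul_rpow (by norm_num) hs.le, Real.rpow_neg (by norm_num)]
    have h2 : (2:ℝ) ^ (3/4 : ℝ) ≤ 2 := by
      calc (2:ℝ) ^ (3/4 : ℝ) ≤ 2 ^ (1:ℝ) := Real.rpow_le_rpow_of_exponent_le (by norm_num) (by norm_num)
        _ = 2 := by simp
    have h3 : (2:ℝ)⁻¹ ≤ ((2:ℝ) ^ (3/4 : ℝ))⁻¹ := inv_anti₀ (by positivity) h2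
    have h4 : 0 ≤ s ^ (-(3/4) : ℝ) := by positivity
    nlinarith
  rcases le_or_gt |t| 1 with ht | ht
  · have h1 : (2 * 1 : ℝ) ^ (-(3/4) : ℝ) ≤ (1 + |t|) ^ (-(3/4) : ℝ) :=
      Real.rpow_le_rpow_of_nonpos (by positivity) (by linarith) (by norm_num)
    have h2 := key 1 (by norm_num) (by norm_num)
    rw [Real.one_rpow] at h2
    calc _ ≤ 4 * Real.pi * N := rsK_le_one a N t x h0 h
      _ ≤ 144 * Real.pi * N * (1 / 2) := by
        have : 0 ≤ Real.pi * N := by positivity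
        nlinarith
      _ ≤ _ := by gcongr; linarith
  · have h1 : (2 * |t| : ℝ) ^ (-(3/4) : ℝ) ≤ (1 + |t|) ^ (-(3/4) : ℝ) :=
      Real.rpow_le_rpow_of_nonpos (by positivity) (by linarith) (by norm_num)
    have h2 := key |t| (by linarith) (by linarith)
    calc _ ≤ 72 * Real.pi * N * |t| ^ (-(3/4) : ℝ) := rsK_le_rpow a N t x h0 h (by rintro rfl; simp at ht; linarith)
      _ = 144 * Real.pi * N * (|t| ^ (-(3/4) : ℝ) / 2) := by ring
      _ ≤ _ := by gcongr; linarith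

lemma rs_cs {α : Type*} [MeasurableSpace α] (μ : Measure α) {f g : α → ℝ≥0∞} (hf : AEMeasurable f μ)
    (hg : AEMeasurable g μ) : (∫⁻ a, f a * g a ∂μ) ^ 2 ≤ (∫⁻ a, f a ^ 2 ∂μ) * ∫⁻ a, g a ^ 2 ∂μ := by
  have := ENNReal.lintegral_mul_le_Lp_mul_Lq μ (p := 2) (q := 2) ⟨by norm_num, by norm_num, by norm_num⟩ hf hg
  simp only [Pi.mul_apply, ENNReal.rpow_two] at this
  have h2 := pow_le_pow_left₀ (by simp) this 2
  refine h2.trans_eq ?_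
  rw [mul_pow, ← ENNReal.rpow_two, ← ENNReal.rpow_two, ← ENNReal.rpow_mul, ← ENNReal.rpow_mul]
  norm_num

lemma rs_sq_mul_sq_le (a b : ℝ≥0∞) : a ^ 2 * b ^ 2 ≤ a ^ 4 + b ^ 4 := by
  rcases le_total a b with h | h
  · calc a ^ 2 * b ^ 2 ≤ b ^ 2 * b ^ 2 := by gcongr
      _ = b ^ 4 := by ring
      _ ≤ _ := le_add_self
  · calc a ^ 2 * b ^ 2 ≤ a ^ 2 * a ^ 2 := by gcongr
      _ = a ^ 4 := by ring
      _ ≤ _ := le_self_add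

/-- Decay weight. -/
def rsk (t : ℝ) : ℝ≥0∞ := ENNReal.ofReal ((1 + |t|) ^ (-(3/4) : ℝ))

lemma rsk_meas : Measurable rsk := by
  unfold rsk; fun_prop

lemma rsk_sq : ∫⁻ t, rsk t ^ 2 ≠ ⊤ := by
  have h := integrable_one_add_norm (E := ℝ) (μ := volume) (r := 3/2) (by norm_num)
  have h2 := h.lintegral_lt_top
  refine ne_of_lt (lt_of_eq_of_lt ?_ h2)
  congr 1
  ext t
  unfold rsk
  rw [← ENNReal.ofReal_pow (by positivity), ← Real.rpow_natCast, ← Real.rpow_mul (by positivity), Real.norm_eq_abs]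
  norm_num

lemma rs_young (ν : Measure ℝ) [SFinite ν] (hν : ν ≤ volume) {m : ℝ → ℝ≥0∞} (hm : Measurable m) :
    (∫⁻ p, m p.1 ^ 3 * m p.2 ^ 3 * rsk (p.1 - p.2) ∂(ν.prod ν)) ^ 2 ≤
      2 * (∫⁻ t, rsk t ^ 2) * (∫⁻ t, m t ^ 4 ∂ν) ^ 3 := by
  have hk := rsk_meas
  set X := ∫⁻ t, m t ^ 4 ∂ν with hX
  have e1 : ∫⁻ p, m p.1 ^ 3 * m p.2 ^ 3 * rsk (p.1 - p.2) ∂(ν.prod ν) =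
      ∫⁻ p, (m p.1 ^ 2 * m p.2 ^ 2) * (m p.1 * m p.2 * rsk (p.1 - p.2)) ∂(ν.prod ν) := by
    congr 1; ext p; ring
  rw [e1]
  refine (rs_cs _ (by fun_prop) (by fun_prop)).trans ?_
  have e2 : ∫⁻ p, (m p.1 ^ 2 * m p.2 ^ 2) ^ 2 ∂(ν.prod ν) = X ^ 2 := by
    have : ∫⁻ p, (m p.1 ^ 2 * m p.2 ^ 2) ^ 2 ∂(ν.prod ν) = ∫⁻ p, m p.1 ^ 4 * m p.2 ^ 4 ∂(ν.prod ν) := by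
      congr 1; ext p; ring
    rw [this, lintegral_prod_mul (f := fun t => m t ^ 4) (g := fun t => m t ^ 4) (by fun_prop) (by fun_prop), sq]
  have s1 : ∫⁻ p, m p.1 ^ 4 * rsk (p.1 - p.2) ^ 2 ∂(ν.prod ν) ≤ (∫⁻ t, rsk t ^ 2) * X := by
    rw [lintegral_prod _ (by fun_prop), hX, ← lintegral_const_mul _ (by fun_prop)]
    apply lintegral_mono
    intro t
    simp only
    rw [lintegral_const_mul _ (by fun_prop), mul_comm]
    refine mul_le_mul' ?_ le_rfl
    refine (lintegral_mono' hν le_rfl).trans ?_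
    rw [lintegral_sub_left_eq_self (fun s => rsk s ^ 2)]
  have s2 : ∫⁻ p, m p.2 ^ 4 * rsk (p.1 - p.2) ^ 2 ∂(ν.prod ν) ≤ (∫⁻ t, rsk t ^ 2) * X := by
    rw [lintegral_prod_symm _ (by fun_prop), hX, ← lintegral_const_mul _ (by fun_prop)]
    apply lintegral_mono
    intro t
    simp only
    rw [lintegral_const_mul _ (by fun_prop), mul_comm]
    refine mul_le_mul' ?_ le_rfl
    refine (lintegral_mono' hν le_rfl).trans ?_
    rw [lintegral_sub_right_eq_self (fun s => rsk s ^ 2)]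
  have e3 : ∫⁻ p, (m p.1 * m p.2 * rsk (p.1 - p.2)) ^ 2 ∂(ν.prod ν) ≤ 2 * (∫⁻ t, rsk t ^ 2) * X := by
    calc _ ≤ ∫⁻ p, (m p.1 ^ 4 * rsk (p.1 - p.2) ^ 2 + m p.2 ^ 4 * rsk (p.1 - p.2) ^ 2) ∂(ν.prod ν) := by
          apply lintegral_mono
          intro p
          simp only [mul_pow]
          rw [← add_mul]
          gcongr
          exact rs_sq_mul_sq_le _ _
      _ ≤ _ := by
          rw [lintegral_add_left (by fun_prop), two_mul, add_mul]
          exact add_le_add s1 s2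
  rw [e2]
  calc _ ≤ X ^ 2 * (2 * (∫⁻ t, rsk t ^ 2) * X) := by gcongr
    _ = _ := by ring

/-- Truncated exponential. -/
def rsE (a t : ℝ) (x ξ : RS3) : ℂ := if ‖ξ‖ < a then Complex.exp (Complex.I * Complex.ofReal (rsPh t x ξ)) else 0

/-- Truncated evolution. -/
def rsL (h : RS3 → ℂ) (a t : ℝ) (x : RS3) : ℂ := ∫ ξ, rsE a t x ξ * h ξ

lemma rsE_meas {α : Type*} [MeasurableSpace α] {a t : α → ℝ} {x ξ : α → RS3} (ha : Measurable a)
    (ht : Measurable t) (hx : Measurable x) (hξ : Measurable ξ) :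
    Measurable (fun p => rsE (a p) (t p) (x p) (ξ p)) := by
  unfold rsE
  have := rsPh_meas ht hx hξ
  exact Measurable.ite (measurableSet_lt (by fun_prop) ha) (by fun_prop) measurable_const

lemma rsE_norm (a t : ℝ) (x ξ : RS3) : ‖rsE a t x ξ‖ ≤ 1 := by
  unfold rsE
  split_ifs
  · rw [mul_comm I, Complex.norm_exp_ofReal_mul_I]
  · simp

lemma rsL_meas {h : RS3 → ℂ} (hh : Measurable h) {α : Type*} [MeasurableSpace α] {a t : α → ℝ} {x : α → RS3}
    (ha : Measurable a) (ht : Measurable t) (hx : Measurable x) :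
    Measurable (fun p => rsL h (a p) (t p) (x p)) := by
  unfold rsL
  apply StronglyMeasurable.measurable
  apply StronglyMeasurable.integral_prod_right (f := fun p ξ => rsE (a p) (t p) (x p) ξ * h ξ)
  apply Measurable.stronglyMeasurable
  have := rsE_meas (ha.comp measurable_fst) (ht.comp measurable_fst) (hx.comp measurable_fst)
    (measurable_snd (α := α) (β := RS3))
  have h2 : Measurable (fun p : α × RS3 => h p.2) := hh.comp measurable_snd
  exact this.mul h2

lemma rsL_norm {h : RS3 → ℂ} (hi : Integrable h) (a t : ℝ) (x : RS3) : ‖rsL h a t x‖ ≤ ∫ ξ, ‖h ξ‖ := by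
  unfold rsL
  apply norm_integral_le_of_norm_le hi.norm
  filter_upwards with ξ
  rw [norm_mul]
  exact mul_le_of_le_one_left (norm_nonneg _) (rsE_norm _ _ _ _)

lemma rs_enorm_int {α : Type*} [MeasurableSpace α] {μ : Measure α} {W : α → ℂ} (hW : Integrable W μ)
    (h : ∀ a, W a = ((‖W a‖ : ℝ) : ℂ)) : ∫⁻ a, ‖W a‖ₑ ∂μ = ‖∫ a, W a ∂μ‖ₑ := by
  rw [← ofReal_integral_norm_eq_lintegral_enorm hW]
  have : ∫ a, W a ∂μ = ((∫ a, ‖W a‖ ∂μ : ℝ) : ℂ) := by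
    rw [← integral_complex_ofReal]
    congr 1; ext a; exact h a
  rw [this, ← ofReal_norm, Complex.norm_real, Real.norm_eq_abs, abs_of_nonneg (integral_nonneg (fun _ => norm_nonneg _))]

lemma rsE_mul_conj (a b t s : ℝ) (x y ξ : RS3) :
    ((‖ξ‖ ^ 2)⁻¹ : ℝ) • (rsE a t x ξ * (starRingEnd ℂ) (rsE b s y ξ)) =
    (Metric.ball (0:RS3) (min a b)).indicator (fun ξ => ((‖ξ‖ ^ 2)⁻¹ : ℝ) •
      Complex.exp (Complex.I * Complex.ofReal (rsPh (t - s) (x - y) ξ))) ξ := by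
  by_cases h1 : ‖ξ‖ < a
  · by_cases h2 : ‖ξ‖ < b
    · rw [Set.indicator_of_mem (by simp [h1, h2])]
      simp only [rsE, h1, h2, if_true]
      congr 1
      rw [← Complex.exp_conj, ← Complex.exp_add]
      congr 1
      simp only [rsPh, map_mul, Complex.conj_I, Complex.conj_ofReal, inner_sub_left]
      push_cast
      ring
    · rw [Set.indicator_of_notMem (by simp [h2])]
      simp [rsE, h2]
  · rw [Set.indicator_of_notMem (by simp [h1])]
    simp [rsE, h1]

lemma rsK_int_eq (a b t s : ℝ) (x y : RS3) :
    ∫ ξ, ((‖ξ‖ ^ 2)⁻¹ : ℝ) • (rsE a t x ξ * (starRingEnd ℂ) (rsE b s y ξ)) =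
    rsK (min a b) (t - s) (x - y) := by
  simp_rw [rsE_mul_conj]
  rw [integral_indicator Metric.isOpen_ball.measurableSet]
  rfl

/-- `T T*` estimate of the dual operator. -/
lemma rs_dual (ν : Measure ℝ) [IsFiniteMeasure ν] {N : ℝ} {a : ℝ → ℝ} {x : ℝ → RS3}
    (ha : Measurable a) (hx : Measurable x) (ha0 : ∀ t, 0 ≤ a t) (haN : ∀ t, a t ≤ N)
    {f : ℝ → ℂ} (hf : Measurable f) {B : ℝ} (hfB : ∀ t, ‖f t‖ ≤ B) :
    ∫⁻ ξ, ENNReal.ofReal ((‖ξ‖ ^ 2)⁻¹) * ‖∫ t, f t * rsE (a t) t (x t) ξ ∂ν‖ₑ ^ 2 ≤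
      ENNReal.ofReal (144 * Real.pi * N) * ∫⁻ p, ‖f p.1‖ₑ * ‖f p.2‖ₑ * rsk (p.1 - p.2) ∂(ν.prod ν) := by
  set F : (ℝ × ℝ) → RS3 → ℂ := fun p ξ => (f p.1 * (starRingEnd ℂ) (f p.2)) * (((‖ξ‖ ^ 2)⁻¹ : ℝ) •
    (rsE (a p.1) p.1 (x p.1) ξ * (starRingEnd ℂ) (rsE (a p.2) p.2 (x p.2) ξ))) with hF
  have hfm : Integrable f ν := (integrable_const B).mono' hf.aestronglyMeasurable (by filter_upwards with t using hfB t)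
  have hfc : Integrable (fun p : ℝ × ℝ => f p.1 * (starRingEnd ℂ) (f p.2)) (ν.prod ν) := by
    have h2 : Integrable (fun t => (starRingEnd ℂ) (f t)) ν := by
      refine hfm.norm.mono' (by fun_prop) ?_
      filter_upwards with t
      simp
    exact hfm.mul_prod h2
  have hFm : Measurable (Function.uncurry F) := by
    have m1 : Measurable (fun q : (ℝ × ℝ) × RS3 => rsE (a q.1.1) q.1.1 (x q.1.1) q.2) :=
      rsE_meas (by fun_prop) (by fun_prop) (by fun_prop) (by fun_prop)
    have m2 : Measurable (fun q : (ℝ × ℝ) × RS3 => rsE (a q.1.2) q.1.2 (x q.1.2) q.2) :=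
      rsE_meas (by fun_prop) (by fun_prop) (by fun_prop) (by fun_prop)
    have m3 : Measurable (fun q : (ℝ × ℝ) × RS3 => (starRingEnd ℂ) (rsE (a q.1.2) q.1.2 (x q.1.2) q.2)) :=
      Complex.continuous_conj.measurable.comp m2
    have m4 : Measurable (fun q : (ℝ × ℝ) × RS3 => (starRingEnd ℂ) (f q.1.2)) :=
      Complex.continuous_conj.measurable.comp (by fun_prop)
    simp only [hF, Function.uncurry_def]
    fun_prop
  have hFi : Integrable (Function.uncurry F) ((ν.prod ν).prod volume) := by
    have h1 := (hfc.norm).mul_prod ((integrable_indicator_iff Metric.isOpen_ball.measurableSet).2 (rs_inv_sq_integrable N))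
    refine h1.mono' hFm.aestronglyMeasurable ?_
    filter_upwards with q
    simp only [hF, Function.uncurry_def]
    rw [norm_mul]
    refine mul_le_mul_of_nonneg_left ?_ (norm_nonneg _)
    rw [rsE_mul_conj]
    by_cases h : ‖q.2‖ < min (a q.1.1) (a q.1.2)
    · rw [Set.indicator_of_mem (by simpa using h), Set.indicator_of_mem
        (by simpa using (h.trans_le ((min_le_left _ _).trans (haN _)))), norm_smul, mul_comm I, Complex.norm_exp_ofReal_mul_I]
      simp
    · rw [Set.indicator_of_notMem (by simpa using h), norm_zero]
      apply Set.indicator_nonneg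
      intro y _
      positivity
  have hW : ∀ ξ, ∫ p, F p ξ ∂(ν.prod ν) = ((‖ξ‖ ^ 2)⁻¹ : ℝ) • ((∫ t, f t * rsE (a t) t (x t) ξ ∂ν) *
      (starRingEnd ℂ) (∫ t, f t * rsE (a t) t (x t) ξ ∂ν)) := by
    intro ξ
    rw [← integral_conj, ← integral_prod_mul, ← integral_smul]
    congr 1
    ext p
    simp only [hF, map_mul, Complex.real_smul]
    ring
  have hWi : Integrable (fun ξ => ∫ p, F p ξ ∂(ν.prod ν)) := hFi.integral_prod_right
  have e1 : ∀ ξ, ENNReal.ofReal ((‖ξ‖ ^ 2)⁻¹) * ‖∫ t, f t * rsE (a t) t (x t) ξ ∂ν‖ₑ ^ 2 = ‖∫ p, F p ξ ∂(ν.prod ν)‖ₑ := by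
    intro ξ
    rw [hW, enorm_smul, enorm_mul, RCLike.enorm_conj, ← sq, Real.enorm_eq_ofReal (by positivity)]
  simp_rw [e1]
  rw [rs_enorm_int hWi]
  · rw [← integral_integral_swap hFi, ← lintegral_const_mul _ (by have := rsk_meas; fun_prop)]
    refine (enorm_integral_le_lintegral_enorm _).trans ?_
    apply lintegral_mono
    intro p
    simp only [hF]
    rw [integral_const_mul, rsK_int_eq, enorm_mul, enorm_mul, RCLike.enorm_conj, mul_left_comm (ENNReal.ofReal _)]
    refine mul_le_mul' le_rfl ?_
    unfold rsk
    have hN : 0 ≤ N := (ha0 0).trans (haN 0)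
    rw [← ENNReal.ofReal_mul (by have := Real.pi_pos; positivity), ← ofReal_norm]
    exact ENNReal.ofReal_le_ofReal (rsK_le _ _ _ _ (le_min (ha0 _) (ha0 _)) ((min_le_left _ _).trans (haN _)))
  · intro ξ
    rw [hW, Complex.mul_conj]
    simp [Complex.normSq_eq_norm_sq]

/-- The `L⁴` in time bound along measurable selections. -/
lemma rs_L4_fin (ν : Measure ℝ) [IsFiniteMeasure ν] (hν : ν ≤ volume) {N : ℝ} {a : ℝ → ℝ} {x : ℝ → RS3}
    (ha : Measurable a) (hx : Measurable x) (ha0 : ∀ t, 0 ≤ a t) (haN : ∀ t, a t ≤ N)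
    {h : RS3 → ℂ} (hh : Measurable h) (hi : Integrable h) :
    ∫⁻ t, ‖rsL h (a t) t (x t)‖ₑ ^ 4 ∂ν ≤ ENNReal.ofReal (144 * Real.pi * N) ^ 2 * (2 * ∫⁻ t, rsk t ^ 2) *
      (∫⁻ ξ, ‖ξ‖ₑ ^ 2 * ‖h ξ‖ₑ ^ 2) ^ 2 := by
  set c : ℝ → ℂ := fun t => rsL h (a t) t (x t) with hc
  have hcm : Measurable c := rsL_meas hh ha measurable_id hx
  set M := ∫ ξ, ‖h ξ‖ with hM
  have hM0 : 0 ≤ M := integral_nonneg (fun _ => norm_nonneg _)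
  have hcM : ∀ t, ‖c t‖ ≤ M := fun t => rsL_norm hi _ _ _
  set f : ℝ → ℂ := fun t => ((‖c t‖ ^ 2 : ℝ) : ℂ) * (starRingEnd ℂ) (c t) with hf
  have hfm : Measurable f := by
    have : Measurable (fun t => (starRingEnd ℂ) (c t)) := Complex.continuous_conj.measurable.comp hcm
    fun_prop
  have hfn : ∀ t, ‖f t‖ = ‖c t‖ ^ 3 := by
    intro t
    simp only [hf, norm_mul, Complex.norm_real, RCLike.norm_conj]
    simp
    ring
  have hfe : ∀ t, ‖f t‖ₑ = ‖c t‖ₑ ^ 3 := by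
    intro t
    rw [← ofReal_norm, hfn, ENNReal.ofReal_pow (norm_nonneg _), ofReal_norm]
  have hfB : ∀ t, ‖f t‖ ≤ M ^ 3 := fun t => by
    rw [hfn]; exact pow_le_pow_left₀ (norm_nonneg _) (hcM t) 3
  set X := ∫⁻ t, ‖c t‖ₑ ^ 4 ∂ν with hX
  have hXfin : X ≠ ⊤ := by
    have : X ≤ ∫⁻ t, ENNReal.ofReal M ^ 4 ∂ν := by
      apply lintegral_mono
      intro t
      simp only
      gcongr
      rw [← ofReal_norm]
      exact ENNReal.ofReal_le_ofReal (hcM t)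
    refine ne_top_of_le_ne_top ?_ this
    rw [lintegral_const]
    exact ENNReal.mul_ne_top (by simp) (measure_ne_top _ _)
  have hfi : Integrable f ν := (integrable_const (M ^ 3)).mono' hfm.aestronglyMeasurable (by filter_upwards with t using hfB t)
  set H : RS3 → ℂ := fun ξ => ∫ t, f t * rsE (a t) t (x t) ξ ∂ν with hH
  have hEm : Measurable (fun q : ℝ × RS3 => rsE (a q.1) q.1 (x q.1) q.2) :=
      rsE_meas (by fun_prop) (by fun_prop) (by fun_prop) (by fun_prop)
  have hHm : Measurable H := by
    apply StronglyMeasurable.measurable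
    apply StronglyMeasurable.integral_prod_left (f := fun t ξ => f t * rsE (a t) t (x t) ξ)
    apply Measurable.stronglyMeasurable
    simp only [Function.uncurry_def]
    fun_prop
  have d1 : X = ‖∫ ξ, h ξ * H ξ‖ₑ := by
    have k1 : ∀ t, f t * c t = ((‖c t‖ ^ 4 : ℝ) : ℂ) := by
      intro t
      simp only [hf]
      rw [mul_assoc, mul_comm ((starRingEnd ℂ) (c t)), Complex.mul_conj, Complex.normSq_eq_norm_sq]
      push_cast
      ring
    have k2 : X = ‖∫ t, f t * c t ∂ν‖ₑ := by
      rw [← rs_enorm_int]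
      · rw [hX]
        congr 1
        ext t
        rw [enorm_mul, hfe]
        ring
      · refine (hfi.norm.mul_const M).mono' (by fun_prop) ?_
        filter_upwards with t
        rw [norm_mul]
        exact mul_le_mul_of_nonneg_left (hcM t) (norm_nonneg _)
      · intro t
        rw [k1, Complex.norm_real]
        simp
    rw [k2]
    congr 1
    have k3 : Integrable (Function.uncurry (fun t ξ => f t * (rsE (a t) t (x t) ξ * h ξ))) (ν.prod volume) := by
      refine (hfi.norm.mul_prod hi.norm).mono' ?_ ?_
      · apply Measurable.aestronglyMeasurable
        simp only [Function.uncurry_def]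
        fun_prop
      · filter_upwards with q
        simp only [Function.uncurry_def]
        rw [norm_mul, norm_mul (rsE _ _ _ _)]
        refine mul_le_mul_of_nonneg_left ?_ (norm_nonneg _)
        exact mul_le_of_le_one_left (norm_nonneg _) (rsE_norm _ _ _ _)
    simp only [hc, rsL, ← integral_const_mul]
    rw [integral_integral_swap k3]
    congr 1
    ext ξ
    simp only [hH, ← integral_const_mul]
    congr 1
    ext t
    ring
  have d2 : X ≤ ∫⁻ ξ, (‖ξ‖ₑ * ‖h ξ‖ₑ) * (‖ξ‖ₑ⁻¹ * ‖H ξ‖ₑ) := by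
    rw [d1]
    refine (enorm_integral_le_lintegral_enorm _).trans (le_of_eq ?_)
    apply lintegral_congr_ae
    have : ∀ᵐ ξ : RS3, ξ ≠ 0 := by simp [ae_iff]
    filter_upwards [this] with ξ hξ
    rw [enorm_mul]
    have : ‖ξ‖ₑ * ‖ξ‖ₑ⁻¹ = 1 := ENNReal.mul_inv_cancel (by simpa using hξ) (by simp)
    calc ‖h ξ‖ₑ * ‖H ξ‖ₑ = (‖ξ‖ₑ * ‖ξ‖ₑ⁻¹) * (‖h ξ‖ₑ * ‖H ξ‖ₑ) := by rw [this, one_mul]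
      _ = _ := by ring
  have d3 := rs_cs (volume : Measure RS3) (f := fun ξ => ‖ξ‖ₑ * ‖h ξ‖ₑ) (g := fun ξ => ‖ξ‖ₑ⁻¹ * ‖H ξ‖ₑ) (by fun_prop) (by fun_prop)
  simp only [mul_pow] at d3
  set A := ∫⁻ ξ, ‖ξ‖ₑ ^ 2 * ‖h ξ‖ₑ ^ 2 with hA
  have d4 : ∫⁻ ξ, ‖ξ‖ₑ⁻¹ ^ 2 * ‖H ξ‖ₑ ^ 2 = ∫⁻ ξ, ENNReal.ofReal ((‖ξ‖ ^ 2)⁻¹) * ‖H ξ‖ₑ ^ 2 := by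
    apply lintegral_congr_ae
    have : ∀ᵐ ξ : RS3, ξ ≠ 0 := by simp [ae_iff]
    filter_upwards [this] with ξ hξ
    rw [ENNReal.ofReal_inv_of_pos (by positivity), ENNReal.ofReal_pow (norm_nonneg _), ofReal_norm, ENNReal.inv_pow]
  have d5 := rs_dual ν ha hx ha0 haN hfm hfB
  have d6 := rs_young ν hν (m := fun t => ‖c t‖ₑ) (by fun_prop)
  simp only [← hfe] at d6
  rw [← d4] at d5
  have d7 : X ^ 4 ≤ A ^ 2 * (ENNReal.ofReal (144 * Real.pi * N) ^ 2 * (2 * (∫⁻ t, rsk t ^ 2) * X ^ 3)) := by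
    calc X ^ 4 = (X ^ 2) ^ 2 := by ring
      _ ≤ (A * ∫⁻ ξ, ‖ξ‖ₑ⁻¹ ^ 2 * ‖H ξ‖ₑ ^ 2) ^ 2 := by
          gcongr
          exact (pow_le_pow_left₀ (by simp) d2 2).trans d3
      _ ≤ (A * (ENNReal.ofReal (144 * Real.pi * N) * ∫⁻ p, ‖f p.1‖ₑ * ‖f p.2‖ₑ * rsk (p.1 - p.2) ∂(ν.prod ν))) ^ 2 := by
          gcongr
      _ = A ^ 2 * (ENNReal.ofReal (144 * Real.pi * N) ^ 2 * (∫⁻ p, ‖f p.1‖ₑ * ‖f p.2‖ₑ * rsk (p.1 - p.2) ∂(ν.prod ν)) ^ 2) := by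
          ring
      _ ≤ _ := by gcongr
  by_cases hX0 : X = 0
  · rw [hX0]; simp
  · have h3 : X ^ 3 ≠ 0 := pow_ne_zero _ hX0
    have h4 : X ^ 3 ≠ ⊤ := ENNReal.pow_ne_top hXfin
    rw [← ENNReal.mul_le_mul_iff_left h3 h4]
    calc X * X ^ 3 = X ^ 4 := by ring
      _ ≤ _ := d7
      _ = _ := by ring

lemma rs_L4 {N : ℝ} {a : ℝ → ℝ} {x : ℝ → RS3}
    (ha : Measurable a) (hx : Measurable x) (ha0 : ∀ t, 0 ≤ a t) (haN : ∀ t, a t ≤ N)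
    {h : RS3 → ℂ} (hh : Measurable h) (hi : Integrable h) :
    ∫⁻ t, ‖rsL h (a t) t (x t)‖ₑ ^ 4 ≤ ENNReal.ofReal (144 * Real.pi * N) ^ 2 * (2 * ∫⁻ t, rsk t ^ 2) *
      (∫⁻ ξ, ‖ξ‖ₑ ^ 2 * ‖h ξ‖ₑ ^ 2) ^ 2 := by
  have h1 := iSup_lintegral_measurable_le_eq_lintegral (μ := (volume : Measure ℝ)) (fun t => ‖rsL h (a t) t (x t)‖ₑ ^ 4)
  have hU : (⋃ n : ℕ, Metric.ball (0:ℝ) n) = Set.univ := Metric.iUnion_ball_nat 0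
  have hmono : Monotone (fun n : ℕ => Metric.ball (0:ℝ) n) := fun m n hmn => Metric.ball_subset_ball (by exact_mod_cast hmn)
  have h2 : ∫⁻ t, ‖rsL h (a t) t (x t)‖ₑ ^ 4 = ⨆ n : ℕ, ∫⁻ t in Metric.ball (0:ℝ) n, ‖rsL h (a t) t (x t)‖ₑ ^ 4 := by
    rw [← setLIntegral_iUnion_of_directed _ hmono.directed_le, hU, setLIntegral_univ]
  rw [h2]
  apply iSup_le
  intro n
  have : IsFiniteMeasure ((volume : Measure ℝ).restrict (Metric.ball (0:ℝ) n)) :=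
    ⟨by rw [Measure.restrict_apply_univ]; exact measure_ball_lt_top⟩
  exact rs_L4_fin _ Measure.restrict_le_self ha hx ha0 haN hh hi

/-- Enumeration of the pairs (radius, position). -/
def rsIdx (n : ℕ) : ℚ × ℕ := Classical.choose (exists_surjective_nat (ℚ × ℕ)) n

lemma rsIdx_surj : Function.Surjective rsIdx := Classical.choose_spec (exists_surjective_nat (ℚ × ℕ))

/-- Maximal function. -/
def rsM (h : RS3 → ℂ) (t r : ℝ) : ℝ≥0∞ :=
  ⨆ n : ℕ, if 0 ≤ (rsIdx n).1 ∧ ((rsIdx n).1 : ℝ) ≤ r then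
    ‖rsL h (rsIdx n).1 t (TopologicalSpace.denseSeq RS3 (rsIdx n).2)‖ₑ else 0

lemma rsM_meas {h : RS3 → ℂ} (hh : Measurable h) : Measurable (fun p : ℝ × ℝ => rsM h p.1 p.2) := by
  unfold rsM
  refine Measurable.iSup fun n => ?_
  refine Measurable.ite ?_ ?_ measurable_const
  · by_cases h0 : 0 ≤ (rsIdx n).1
    · simp only [h0, true_and]
      exact measurableSet_le measurable_const measurable_snd
    · simp [h0]
  · exact (rsL_meas hh measurable_const measurable_fst measurable_const).enorm

lemma rsM_mono (h : RS3 → ℂ) (t : ℝ) : Monotone (rsM h t) := by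
  intro r r' hr
  unfold rsM
  refine iSup_mono fun n => ?_
  split_ifs with h1 h2
  · exact le_rfl
  · exact absurd ⟨h1.1, h1.2.trans hr⟩ h2
  · simp
  · simp

lemma rsM_le {h : RS3 → ℂ} (hi : Integrable h) (t r : ℝ) : rsM h t r ≤ ENNReal.ofReal (∫ ξ, ‖h ξ‖) := by
  unfold rsM
  refine iSup_le fun n => ?_
  split_ifs with h1
  · rw [← ofReal_norm]
    exact ENNReal.ofReal_le_ofReal (rsL_norm hi _ _ _)
  · simp

lemma rsL_zero (h : RS3 → ℂ) (t : ℝ) (x : RS3) : rsL h 0 t x = 0 := by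
  unfold rsL rsE
  simp [not_lt.2 (norm_nonneg _)]

lemma rsM_zero (h : RS3 → ℂ) (t : ℝ) : rsM h t 0 = 0 := by
  unfold rsM
  simp only [ENNReal.iSup_eq_zero]
  intro n
  split_ifs with h1
  · have : ((rsIdx n).1 : ℝ) = 0 := le_antisymm h1.2 (by exact_mod_cast h1.1)
    rw [this, rsL_zero]; simp
  · rfl

lemma rsM_cont {h : RS3 → ℂ} (hh : Measurable h) (hi : Integrable h) (a t : ℝ) : Continuous (fun x => rsL h a t x) := by
  unfold rsL
  refine continuous_of_dominated (bound := fun ξ => ‖h ξ‖) ?_ ?_ hi.norm ?_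
  · intro x
    have := rsE_meas (measurable_const (a := a)) (measurable_const (a := t)) (measurable_const (a := x)) (measurable_id (α := RS3))
    simp only [id] at this
    exact (this.mul hh).aestronglyMeasurable
  · intro x
    filter_upwards with ξ
    rw [norm_mul]
    exact mul_le_of_le_one_left (norm_nonneg _) (rsE_norm _ _ _ _)
  · filter_upwards with ξ
    refine Continuous.mul ?_ continuous_const
    unfold rsE rsPh
    split_ifs <;> fun_prop

lemma rsL_le_rsM {h : RS3 → ℂ} (hh : Measurable h) (hi : Integrable h) (q : ℚ) (hq : 0 ≤ q) (t : ℝ) (x : RS3) :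
    ‖rsL h q t x‖ₑ ≤ rsM h t q := by
  have hc : Continuous (fun x => ‖rsL h q t x‖ₑ) := (rsM_cont hh hi q t).enorm
  have hcl : IsClosed {x | ‖rsL h q t x‖ₑ ≤ rsM h t q} := isClosed_le hc continuous_const
  have hd := TopologicalSpace.denseRange_denseSeq RS3
  refine hd.induction_on (p := fun x => ‖rsL h q t x‖ₑ ≤ rsM h t q) x hcl ?_
  intro j
  obtain ⟨n, hn⟩ := rsIdx_surj (q, j)
  unfold rsM
  refine le_trans ?_ (le_iSup _ n)
  simp [hn, hq]

lemma rs_select {h : RS3 → ℂ} (hh : Measurable h) {r : ℝ} (hr : 0 ≤ r) (n : ℕ) :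
    ∃ (a : ℝ → ℝ) (x : ℝ → RS3), Measurable a ∧ Measurable x ∧ (∀ t, 0 ≤ a t) ∧ (∀ t, a t ≤ r) ∧
      ∀ t, ‖rsL h (a t) t (x t)‖ₑ = (Finset.range n).sup (fun n => if 0 ≤ (rsIdx n).1 ∧ ((rsIdx n).1 : ℝ) ≤ r then
    ‖rsL h (rsIdx n).1 t (TopologicalSpace.denseSeq RS3 (rsIdx n).2)‖ₑ else 0) := by
  induction n with
  | zero => exact ⟨fun _ => 0, fun _ => 0, measurable_const, measurable_const, fun _ => le_rfl, fun _ => hr, fun t => by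
      simp [rsL_zero]⟩
  | succ n ih =>
    obtain ⟨a, x, ha, hx, h0, h1, h2⟩ := ih
    by_cases hn : 0 ≤ (rsIdx n).1 ∧ ((rsIdx n).1 : ℝ) ≤ r
    · set a' : ℝ := (((rsIdx n).1 : ℚ) : ℝ) with ha'
      set x' := TopologicalSpace.denseSeq RS3 (rsIdx n).2 with hx'
      have hm : MeasurableSet {t | ‖rsL h (a t) t (x t)‖ₑ ≤ ‖rsL h a' t x'‖ₑ} :=
        measurableSet_le (rsL_meas hh ha measurable_id hx).enorm
          (rsL_meas hh measurable_const measurable_id measurable_const).enorm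
      refine ⟨fun t => if ‖rsL h (a t) t (x t)‖ₑ ≤ ‖rsL h a' t x'‖ₑ then a' else a t,
        fun t => if ‖rsL h (a t) t (x t)‖ₑ ≤ ‖rsL h a' t x'‖ₑ then x' else x t,
        Measurable.ite hm measurable_const ha, Measurable.ite hm measurable_const hx, ?_, ?_, ?_⟩
      · intro t
        simp only
        split_ifs
        · rw [ha']; exact_mod_cast hn.1
        · exact h0 t
      · intro t
        simp only
        split_ifs
        · exact hn.2
        · exact h1 t
      · intro t
        rw [Finset.range_add_one, Finset.sup_insert, ← h2 t, if_pos hn]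
        simp only
        split_ifs with h3
        · exact (sup_eq_left.2 h3).symm
        · exact (sup_eq_right.2 (not_le.1 h3).le).symm
    · refine ⟨a, x, ha, hx, h0, h1, fun t => ?_⟩
      rw [Finset.range_add_one, Finset.sup_insert, ← h2 t, if_neg hn]
      simp

/-- The maximal estimate. -/
lemma rs_max {h : RS3 → ℂ} (hh : Measurable h) (hi : Integrable h) {r : ℝ} (hr : 0 ≤ r) :
    ∫⁻ t, rsM h t r ^ 4 ≤ ENNReal.ofReal (144 * Real.pi * r) ^ 2 * (2 * ∫⁻ t, rsk t ^ 2) *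
      (∫⁻ ξ, ‖ξ‖ₑ ^ 2 * ‖h ξ‖ₑ ^ 2) ^ 2 := by
  set b : ℕ → ℝ → ℝ≥0∞ := fun n t => if 0 ≤ (rsIdx n).1 ∧ ((rsIdx n).1 : ℝ) ≤ r then
    ‖rsL h (rsIdx n).1 t (TopologicalSpace.denseSeq RS3 (rsIdx n).2)‖ₑ else 0 with hb
  have hbm : ∀ n, Measurable (b n) := by
    intro n
    simp only [hb]
    split_ifs
    · exact (rsL_meas hh measurable_const measurable_id measurable_const).enorm
    · exact measurable_const
  have e : ∀ t, rsM h t r ^ 4 = ⨆ n : ℕ, ((Finset.range n).sup (fun n => b n t)) ^ 4 := by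
    intro t
    have h1 : rsM h t r = ⨆ n : ℕ, (Finset.range n).sup (fun n => b n t) := by
      unfold rsM
      apply le_antisymm
      · refine iSup_le fun n => ?_
        refine le_trans ?_ (le_iSup _ (n+1))
        exact Finset.le_sup (f := fun n => b n t) (Finset.self_mem_range_succ n)
      · refine iSup_le fun n => Finset.sup_le fun k _ => ?_
        exact le_iSup (fun n => b n t) k
    rw [h1, ENNReal.iSup_pow]
  simp_rw [e]
  rw [lintegral_iSup]
  · refine iSup_le fun n => ?_
    obtain ⟨a, x, ha, hx, h0, h1, h2⟩ := rs_select hh hr n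
    have := rs_L4 ha hx h0 h1 hh hi
    simp_rw [h2] at this
    exact this
  · intro n
    refine Measurable.pow_const ?_ 4
    obtain ⟨a, x, ha, hx, h0, h1, h2⟩ := rs_select hh hr n
    have : (fun t => (Finset.range n).sup (fun n => b n t)) = fun t => ‖rsL h (a t) t (x t)‖ₑ := by
      ext t; rw [h2]
    rw [this]
    exact (rsL_meas hh ha measurable_id hx).enorm
  · intro m n hmn t
    simp only
    gcongr

/-- Full evolution. -/
def rsU (h : RS3 → ℂ) (t : ℝ) (x : RS3) : ℂ := ∫ ξ, Complex.exp (Complex.I * Complex.ofReal (rsPh t x ξ)) * h ξ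

/-- Spectral measure. -/
def rsMu (h : RS3 → ℂ) : Measure RS3 := volume.withDensity (fun ξ => ‖h ξ‖ₑ ^ 2)

lemma rsExp_norm (t : ℝ) (x ξ : RS3) : ‖Complex.exp (Complex.I * Complex.ofReal (rsPh t x ξ))‖ = 1 := by
  rw [mul_comm I, Complex.norm_exp_ofReal_mul_I]

lemma rsU_meas {h : RS3 → ℂ} (hh : Measurable h) : Measurable (fun p : ℝ × RS3 => rsU h p.1 p.2) := by
  unfold rsU
  apply StronglyMeasurable.measurable
  apply StronglyMeasurable.integral_prod_right
    (f := fun (p : ℝ × RS3) ξ => Complex.exp (Complex.I * Complex.ofReal (rsPh p.1 p.2 ξ)) * h ξ)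
  apply Measurable.stronglyMeasurable
  have h1 : Measurable (fun q : (ℝ × RS3) × RS3 => rsPh q.1.1 q.1.2 q.2) :=
    rsPh_meas (by fun_prop) (by fun_prop) (by fun_prop)
  simp only [Function.uncurry_def]
  fun_prop

lemma rsU_meas' {h : RS3 → ℂ} (hh : Measurable h) (t : ℝ) : Measurable (rsU h t) := by
  have h1 : Measurable (fun x : RS3 => (t, x)) := measurable_const.prodMk measurable_id
  have := Measurable.comp (g := fun p : ℝ × RS3 => rsU h p.1 p.2) (f := fun x : RS3 => (t, x)) (rsU_meas hh) h1
  exact this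

lemma rsM_meas' {h : RS3 → ℂ} (hh : Measurable h) : Measurable (fun p : ℝ × RS3 => rsM h p.1 (2 * ‖p.2‖)) := by
  have h1 : Measurable (fun p : ℝ × RS3 => (p.1, 2 * ‖p.2‖)) := by fun_prop
  have := Measurable.comp (g := fun p : ℝ × ℝ => rsM h p.1 p.2) (f := fun p : ℝ × RS3 => (p.1, 2 * ‖p.2‖)) (rsM_meas hh) h1
  exact this

lemma rsM_meas'' {h : RS3 → ℂ} (hh : Measurable h) (t : ℝ) : Measurable (fun ξ : RS3 => rsM h t (2 * ‖ξ‖)) := by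
  have h1 : Measurable (fun x : RS3 => (t, 2 * ‖x‖)) := by fun_prop
  have := Measurable.comp (g := fun p : ℝ × ℝ => rsM h p.1 p.2) (f := fun x : RS3 => (t, 2 * ‖x‖)) (rsM_meas hh) h1
  exact this

lemma rs_diff {h : RS3 → ℂ} (hh : Measurable h) (hi : Integrable h) (h2 : MemLp h 2) (q t : ℝ) :
    ∫⁻ x, ‖rsU h t x - rsL h q t x‖ₑ ^ 2 = ENNReal.ofReal ((2 * Real.pi) ^ 3) * rsMu h {ξ | q ≤ ‖ξ‖} := by
  set w : RS3 → ℂ := fun ξ => if q ≤ ‖ξ‖ then Complex.exp (Complex.I * Complex.ofReal (t * pRot ξ)) * h ξ else 0 with hw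
  have hs : MeasurableSet {ξ : RS3 | q ≤ ‖ξ‖} := measurableSet_le measurable_const measurable_norm
  have hp : Measurable pRot := by
    unfold pRot
    have : Measurable (fun ξ : RS3 => ξ 2) := by fun_prop
    fun_prop
  have hwm : Measurable w := Measurable.ite hs (by fun_prop) measurable_const
  have hwn : ∀ ξ, ‖w ξ‖ ≤ ‖h ξ‖ := by
    intro ξ
    simp only [hw]
    split_ifs
    · rw [norm_mul, mul_comm I, Complex.norm_exp_ofReal_mul_I, one_mul]
    · simp
  have hw1 : Integrable w := hi.norm.mono' hwm.aestronglyMeasurable (by filter_upwards with ξ using hwn ξ)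
  have hw2 : MemLp w 2 := h2.mono hwm.aestronglyMeasurable (by filter_upwards with ξ using hwn ξ)
  have e : ∀ x, rsU h t x - rsL h q t x = ∫ ξ, cexp (I * ofReal ⟪x, ξ⟫) * w ξ := by
    intro x
    unfold rsU rsL
    have mph := rsPh_meas (measurable_const (a := t)) (measurable_const (a := x)) (measurable_id (α := RS3))
    have mE := rsE_meas (measurable_const (a := q)) (measurable_const (a := t)) (measurable_const (a := x)) (measurable_id (α := RS3))
    simp only [id] at mph mE
    rw [← integral_sub]
    · congr 1
      ext ξ
      simp only [hw, rsE, rsPh]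
      by_cases hq : ‖ξ‖ < q
      · simp [hq, not_le.2 hq]
      · simp only [hq, not_lt.1 hq, if_true, if_false]
        rw [← mul_assoc, ← Complex.exp_add]
        push_cast
        ring_nf
    · refine hi.norm.mono' (by fun_prop) ?_
      filter_upwards with ξ
      rw [norm_mul, rsExp_norm, one_mul]
    · refine hi.norm.mono' (by fun_prop) ?_
      filter_upwards with ξ
      rw [norm_mul]
      exact mul_le_of_le_one_left (norm_nonneg _) (rsE_norm _ _ _ _)
  simp_rw [e]
  rw [rs_plancherel hw1 hw2]
  congr 1
  rw [rsMu, withDensity_apply _ hs, ← lintegral_indicator hs]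
  congr 1
  ext ξ
  simp only [hw, Set.indicator, Set.mem_ofPred_eq]
  split_ifs
  · rw [enorm_mul, ← ofReal_norm (cexp _), mul_comm I, Complex.norm_exp_ofReal_mul_I]
    simp
  · simp

lemma rsMu_fin {h : RS3 → ℂ} (h2 : MemLp h 2) : IsFiniteMeasure (rsMu h) := by
  unfold rsMu
  apply isFiniteMeasure_withDensity
  have := h2.eLpNorm_lt_top
  rw [eLpNorm_lt_top_iff_lintegral_rpow_enorm_lt_top (by norm_num) (by norm_num)] at this
  simpa using this.ne

/-- Distribution function comparison. -/
lemma rs_dist {h : RS3 → ℂ} (hh : Measurable h) (hi : Integrable h) (h2 : MemLp h 2) (t : ℝ) {l : ℝ} (hl : 0 < l) :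
    volume {x | l < ‖rsU h t x‖} ≤ ENNReal.ofReal (4 * (2 * Real.pi) ^ 3 / l ^ 2) *
      rsMu h {ξ | l < 2 * (rsM h t (2 * ‖ξ‖)).toReal} := by
  have hfin := rsMu_fin h2
  have hMfin : ∀ r, rsM h t r ≠ ⊤ := fun r => ne_top_of_le_ne_top ENNReal.ofReal_ne_top (rsM_le hi t r)
  set S : Set ℚ := {q | 0 ≤ q ∧ 2 * (rsM h t q).toReal ≤ l} with hS
  have h0S : (0:ℚ) ∈ S := by
    refine ⟨le_rfl, ?_⟩
    simp only [Rat.cast_zero, rsM_zero]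
    simpa using hl.le
  have key : ∀ q : S, volume {x | l < ‖rsU h t x‖} ≤ ENNReal.ofReal (4 * (2 * Real.pi) ^ 3 / l ^ 2) *
      rsMu h {ξ | ((q : ℚ) : ℝ) ≤ ‖ξ‖} := by
    rintro ⟨q, hq0, hq⟩
    have hb : ∀ x, 2 * ‖rsL h q t x‖ ≤ l := by
      intro x
      have := rsL_le_rsM hh hi q hq0 t x
      have h3 := ENNReal.toReal_mono (hMfin q) this
      rw [toReal_enorm] at h3
      linarith
    have hUm : Measurable (rsU h t) := rsU_meas' hh t
    have hLm : Measurable (fun x => rsL h q t x) := rsL_meas hh measurable_const measurable_const measurable_id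
    have m1 := mul_meas_ge_le_lintegral₀ (μ := (volume : Measure RS3)) (f := fun x => ‖rsU h t x - rsL h q t x‖ₑ ^ 2) (by fun_prop)
      (ENNReal.ofReal (l ^ 2 / 4))
    rw [rs_diff hh hi h2] at m1
    have hsub : {x | l < ‖rsU h t x‖} ⊆ {x | ENNReal.ofReal (l ^ 2 / 4) ≤ ‖rsU h t x - rsL h q t x‖ₑ ^ 2} := by
      intro x hx
      simp only [Set.mem_ofPred_eq] at hx ⊢
      rw [← ofReal_norm, ← ENNReal.ofReal_pow (norm_nonneg _)]
      apply ENNReal.ofReal_le_ofReal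
      have h3 := norm_sub_norm_le (rsU h t x) (rsL h q t x)
      have h4 := hb x
      have : l / 2 ≤ ‖rsU h t x - rsL h q t x‖ := by linarith
      nlinarith
    have m2 := (mul_le_mul' (le_refl (ENNReal.ofReal (l ^ 2 / 4))) (measure_mono (μ := volume) hsub)).trans m1
    calc volume {x | l < ‖rsU h t x‖} = ENNReal.ofReal (4 / l ^ 2) * (ENNReal.ofReal (l ^ 2 / 4) * volume {x | l < ‖rsU h t x‖}) := by
          rw [← mul_assoc, ← ENNReal.ofReal_mul (by positivity)]
          rw [show 4 / l ^ 2 * (l ^ 2 / 4) = 1 by field_simp]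
          simp
      _ ≤ ENNReal.ofReal (4 / l ^ 2) * _ := mul_le_mul' le_rfl m2
      _ = _ := by
          rw [← mul_assoc, ← ENNReal.ofReal_mul (by positivity)]
          congr 2
          ring
  have hsm : ∀ q : S, NullMeasurableSet {ξ : RS3 | ((q : ℚ) : ℝ) ≤ ‖ξ‖} (rsMu h) := fun q =>
    (measurableSet_le measurable_const measurable_norm).nullMeasurableSet
  have hdir : Directed (· ⊇ ·) (fun q : S => {ξ : RS3 | ((q : ℚ) : ℝ) ≤ ‖ξ‖}) := by
    apply Antitone.directed_ge
    intro p q hpq ξ hξ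
    have : ((p : ℚ) : ℝ) ≤ ((q : ℚ) : ℝ) := by exact_mod_cast hpq
    exact this.trans hξ
  have hInt := hdir.measure_iInter hsm ⟨⟨0, h0S⟩, measure_ne_top _ _⟩
  have k1 : volume {x | l < ‖rsU h t x‖} ≤ ENNReal.ofReal (4 * (2 * Real.pi) ^ 3 / l ^ 2) *
      rsMu h (⋂ q : S, {ξ | ((q : ℚ) : ℝ) ≤ ‖ξ‖}) := by
    rw [hInt]
    have : Nonempty S := ⟨⟨0, h0S⟩⟩
    rw [ENNReal.mul_iInf_of_ne (by simp; have := Real.pi_pos; positivity) ENNReal.ofReal_ne_top]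
    exact le_iInf key
  refine k1.trans (mul_le_mul' le_rfl ?_)
  apply measure_mono_ae
  have hz : ∀ᵐ ξ ∂(rsMu h), ξ ≠ 0 := by
    have hz' : ∀ᵐ ξ : RS3, ξ ≠ 0 := by simp [ae_iff]
    exact (withDensity_absolutelyContinuous _ _).ae_le hz'
  filter_upwards [hz] with ξ hξ hmem
  show l < 2 * (rsM h t (2 * ‖ξ‖)).toReal
  by_contra hcon
  push Not at hcon
  have hpos : 0 < ‖ξ‖ := norm_pos_iff.2 hξ
  obtain ⟨q, hq1, hq2⟩ := exists_rat_btwn (show ‖ξ‖ < 2 * ‖ξ‖ by linarith)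
  have hqS : q ∈ S := by
    refine ⟨by exact_mod_cast (hpos.trans hq1).le, ?_⟩
    have := ENNReal.toReal_mono (hMfin _) (rsM_mono h t hq2.le)
    linarith
  have := Set.mem_iInter.1 hmem ⟨q, hqS⟩
  simp only [Set.mem_ofPred_eq] at this
  linarith

lemma rs_fixed_t {h : RS3 → ℂ} (hh : Measurable h) (hi : Integrable h) (h2 : MemLp h 2) (t : ℝ) :
    ∫⁻ x, ‖rsU h t x‖ₑ ^ 6 ≤ ENNReal.ofReal (96 * (2 * Real.pi) ^ 3) *
      ∫⁻ ξ, ‖h ξ‖ₑ ^ 2 * rsM h t (2 * ‖ξ‖) ^ 4 := by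
  have hMfin : ∀ r, rsM h t r ≠ ⊤ := fun r => ne_top_of_le_ne_top ENNReal.ofReal_ne_top (rsM_le hi t r)
  have hUm : Measurable (rsU h t) := rsU_meas' hh t
  have hMm : Measurable (fun ξ : RS3 => rsM h t (2 * ‖ξ‖)) := rsM_meas'' hh t
  have hmm : Measurable (fun ξ : RS3 => 2 * (rsM h t (2 * ‖ξ‖)).toReal) := by fun_prop
  have c1 := lintegral_rpow_eq_lintegral_meas_lt_mul (volume : Measure RS3) (f := fun x => ‖rsU h t x‖)
    (by filter_upwards with x using norm_nonneg _) (by fun_prop) (p := 6) (by norm_num)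
  have c2 := lintegral_rpow_eq_lintegral_meas_lt_mul (rsMu h) (f := fun ξ : RS3 => 2 * (rsM h t (2 * ‖ξ‖)).toReal)
    (by filter_upwards with x using (by positivity)) hmm.aemeasurable (p := 4) (by norm_num)
  have e1 : ∫⁻ x, ‖rsU h t x‖ₑ ^ 6 = ∫⁻ x, ENNReal.ofReal (‖rsU h t x‖ ^ (6:ℝ)) := by
    congr 1
    ext x
    rw [← ofReal_norm, ← ENNReal.ofReal_pow (norm_nonneg _)]
    norm_cast
  have e2 : ∫⁻ ξ, ENNReal.ofReal ((2 * (rsM h t (2 * ‖ξ‖)).toReal) ^ (4:ℝ)) ∂(rsMu h) =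
      16 * ∫⁻ ξ, ‖h ξ‖ₑ ^ 2 * rsM h t (2 * ‖ξ‖) ^ 4 := by
    have : ∀ ξ : RS3, ENNReal.ofReal ((2 * (rsM h t (2 * ‖ξ‖)).toReal) ^ (4:ℝ)) = 16 * rsM h t (2 * ‖ξ‖) ^ 4 := by
      intro ξ
      rw [show (4:ℝ) = ((4:ℕ):ℝ) by norm_num, Real.rpow_natCast, ENNReal.ofReal_pow (by positivity), ENNReal.ofReal_mul (by norm_num),
        ENNReal.ofReal_toReal (hMfin _), mul_pow]
      norm_num
    simp_rw [this]
    rw [lintegral_const_mul _ (by fun_prop), rsMu, lintegral_withDensity_eq_lintegral_mul _ (by fun_prop) (by fun_prop)]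
    rfl
  rw [e2] at c2
  rw [e1, c1]
  calc _ ≤ ENNReal.ofReal 6 * ∫⁻ l in Set.Ioi (0:ℝ), ENNReal.ofReal (4 * (2 * Real.pi) ^ 3) *
        (rsMu h {ξ | l < 2 * (rsM h t (2 * ‖ξ‖)).toReal} * ENNReal.ofReal (l ^ ((4:ℝ) - 1))) := by
        refine mul_le_mul' le_rfl ?_
        apply setLIntegral_mono' measurableSet_Ioi
        intro l hl
        have hl : 0 < l := hl
        refine (mul_le_mul' (rs_dist hh hi h2 t hl) le_rfl).trans (le_of_eq ?_)
        rw [mul_right_comm, mul_comm (rsMu h _), ← mul_assoc, ← ENNReal.ofReal_mul (by have := Real.pi_pos; positivity),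
          ← ENNReal.ofReal_mul (by have := Real.pi_pos; positivity)]
        congr 2
        rw [show (6:ℝ) - 1 = ((5:ℕ):ℝ) by norm_num, show (4:ℝ) - 1 = ((3:ℕ):ℝ) by norm_num, Real.rpow_natCast, Real.rpow_natCast]
        field_simp
    _ = ENNReal.ofReal 6 * (ENNReal.ofReal (4 * (2 * Real.pi) ^ 3) * ∫⁻ l in Set.Ioi (0:ℝ),
        (rsMu h {ξ | l < 2 * (rsM h t (2 * ‖ξ‖)).toReal} * ENNReal.ofReal (l ^ ((4:ℝ) - 1)))) := by
        rw [lintegral_const_mul' _ _ ENNReal.ofReal_ne_top]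
    _ = ENNReal.ofReal (6 * (2 * Real.pi) ^ 3) * (ENNReal.ofReal 4 * ∫⁻ l in Set.Ioi (0:ℝ),
        (rsMu h {ξ | l < 2 * (rsM h t (2 * ‖ξ‖)).toReal} * ENNReal.ofReal (l ^ ((4:ℝ) - 1)))) := by
        rw [← mul_assoc, ← mul_assoc, ← ENNReal.ofReal_mul (by norm_num), ← ENNReal.ofReal_mul (by have := Real.pi_pos; positivity)]
        congr 2
        ring
    _ = _ := by
        rw [← c2, ← mul_assoc]
        congr 1
        rw [show (16:ℝ≥0∞) = ENNReal.ofReal 16 by norm_num, ← ENNReal.ofReal_mul (by have := Real.pi_pos; positivity)]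
        congr 1
        ring

/-- The `L⁶` estimate with unit parameters. -/
lemma rs_main : ∃ C : ℝ, 0 < C ∧ ∀ h : RS3 → ℂ, Measurable h → Integrable h → MemLp h 2 →
    ∫⁻ t, ∫⁻ x, ‖rsU h t x‖ₑ ^ 6 ≤ ENNReal.ofReal C * (∫⁻ ξ, ‖ξ‖ₑ ^ 2 * ‖h ξ‖ₑ ^ 2) ^ 3 := by
  have hp := Real.pi_pos
  set K := ∫⁻ t, rsk t ^ 2 with hK
  refine ⟨(96 * (2 * Real.pi) ^ 3) * ((288 * Real.pi) ^ 2 * (2 * K.toReal)) + 1, by positivity, ?_⟩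
  intro h hh hi h2
  set A := ∫⁻ ξ, ‖ξ‖ₑ ^ 2 * ‖h ξ‖ₑ ^ 2 with hA
  have hMm : Measurable (fun p : ℝ × RS3 => rsM h p.1 (2 * ‖p.2‖)) := rsM_meas' hh
  calc _ ≤ ∫⁻ t, ENNReal.ofReal (96 * (2 * Real.pi) ^ 3) * ∫⁻ ξ, ‖h ξ‖ₑ ^ 2 * rsM h t (2 * ‖ξ‖) ^ 4 :=
        lintegral_mono fun t => rs_fixed_t hh hi h2 t
    _ = ENNReal.ofReal (96 * (2 * Real.pi) ^ 3) * ∫⁻ t, ∫⁻ ξ, ‖h ξ‖ₑ ^ 2 * rsM h t (2 * ‖ξ‖) ^ 4 := by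
        rw [lintegral_const_mul' _ _ ENNReal.ofReal_ne_top]
    _ = ENNReal.ofReal (96 * (2 * Real.pi) ^ 3) * ∫⁻ ξ, ∫⁻ t, ‖h ξ‖ₑ ^ 2 * rsM h t (2 * ‖ξ‖) ^ 4 := by
        rw [lintegral_lintegral_swap]
        simp only [Function.uncurry_def]
        fun_prop
    _ ≤ ENNReal.ofReal (96 * (2 * Real.pi) ^ 3) * ∫⁻ ξ, (ENNReal.ofReal (288 * Real.pi) ^ 2 * (2 * K) * A ^ 2) * (‖ξ‖ₑ ^ 2 * ‖h ξ‖ₑ ^ 2) := by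
        refine mul_le_mul' le_rfl (lintegral_mono fun ξ => ?_)
        simp only
        rw [lintegral_const_mul' _ _ (by simp)]
        refine (mul_le_mul' le_rfl (rs_max hh hi (r := 2 * ‖ξ‖) (by positivity))).trans (le_of_eq ?_)
        rw [show 144 * Real.pi * (2 * ‖ξ‖) = (288 * Real.pi) * ‖ξ‖ by ring, ENNReal.ofReal_mul (by positivity), ofReal_norm]
        ring
    _ = ENNReal.ofReal (96 * (2 * Real.pi) ^ 3) * ((ENNReal.ofReal (288 * Real.pi) ^ 2 * (2 * K) * A ^ 2) * A) := by
        rw [lintegral_const_mul _ (by fun_prop)]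
    _ = ENNReal.ofReal ((96 * (2 * Real.pi) ^ 3) * ((288 * Real.pi) ^ 2 * (2 * K.toReal))) * A ^ 3 := by
        have hKt : ENNReal.ofReal (2 * K.toReal) = 2 * K := by
          rw [ENNReal.ofReal_mul (by norm_num), ENNReal.ofReal_toReal rsk_sq]
          norm_num [hK]
        rw [ENNReal.ofReal_mul (p := 96 * (2 * Real.pi) ^ 3) (by positivity), ENNReal.ofReal_mul (p := (288 * Real.pi) ^ 2) (by positivity),
          hKt, ENNReal.ofReal_pow (p := 288 * Real.pi) (by positivity)]
        ring
    _ ≤ _ := by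
        refine mul_le_mul' (ENNReal.ofReal_le_ofReal (by linarith)) le_rfl

open scoped FourierTransform in
lemma rs_schwartz (g : SchwartzMap RS3 ℂ) : ∃ H : SchwartzMap RS3 ℂ, ∀ ξ, fourierTf (fun x => g x) ξ = H ξ := by
  have hp := Real.pi_pos
  have hc : (2 * Real.pi)⁻¹ ≠ 0 := by positivity
  refine ⟨SchwartzMap.compCLMOfContinuousLinearEquiv ℂ
    (ContinuousLinearEquiv.smulLeft (Units.mk0 ((2 * Real.pi)⁻¹) hc)) (𝓕 g), fun ξ => ?_⟩
  rw [SchwartzMap.compCLMOfContinuousLinearEquiv_apply]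
  simp only [Function.comp]
  rw [SchwartzMap.fourier_coe, Real.fourier_eq]
  unfold fourierTf
  congr 1
  ext x
  rw [Circle.smul_def, Real.fourierChar_apply, smul_eq_mul]
  congr 2
  rw [show (ContinuousLinearEquiv.smulLeft (Units.mk0 ((2 * Real.pi)⁻¹) hc)) ξ = ((2 * Real.pi)⁻¹) • ξ from rfl, inner_smul_right]
  have : (Real.pi : ℂ) ≠ 0 := by exact_mod_cast hp.ne'
  push_cast
  field_simp

lemma rs_lintegral_scale (F : ℝ → ℝ≥0∞) {c : ℝ} (hc : c ≠ 0) (hF : Measurable F) :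
    ∫⁻ t, F (c * t) = ENNReal.ofReal |c⁻¹| * ∫⁻ t, F t := by
  rw [← lintegral_map hF (measurable_const_mul c), Real.map_volume_mul_left hc, lintegral_smul_measure]
  rfl

theorem strichartz_rotating_euler_homogeneous :
    ∃ C : ℝ, 0 < C ∧ ∀ ε : ℝ, 0 < ε → ∀ sgn : ℝ, (sgn = 1 ∨ sgn = -1) →
      ∀ g : SchwartzMap (EuclideanSpace ℝ (Fin 3)) ℂ,
        eLpNorm (fun p : ℝ × EuclideanSpace ℝ (Fin 3) =>
            ∫ ξ : EuclideanSpace ℝ (Fin 3),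
              Complex.exp (Complex.I *
                Complex.ofReal (⟪p.2, ξ⟫ + sgn * (p.1 / ε) * pRot ξ)) *
                fourierTf (fun x => g x) ξ) 6 volume
          ≤ ENNReal.ofReal (C * ε ^ (1 / 6 : ℝ) * sobolevNorm 1 (fun x => g x)) := by
  obtain ⟨C, hC, hmain⟩ := rs_main
  refine ⟨C ^ (1/6 : ℝ), by positivity, ?_⟩
  intro ε hε sgn hsgn g
  obtain ⟨H, hH⟩ := rs_schwartz g
  have hHm : Measurable (fun ξ => H ξ) := H.continuous.measurable
  have hHi : Integrable (fun ξ => H ξ) := H.integrable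
  have hH2 : MemLp (fun ξ => H ξ) 2 := H.memLp 2
  have hm := hmain (fun ξ => H ξ) hHm hHi hH2
  set A : ℝ := ∫ ξ : RS3, ‖ξ‖ ^ 2 * ‖H ξ‖ ^ 2 with hA
  have hA0 : 0 ≤ A := integral_nonneg fun ξ => by positivity
  have hAe : ∫⁻ ξ, ‖ξ‖ₑ ^ 2 * ‖H ξ‖ₑ ^ 2 = ENNReal.ofReal A := by
    rw [hA, ofReal_integral_eq_lintegral_ofReal]
    · congr 1
      ext ξ
      rw [ENNReal.ofReal_mul (by positivity), ENNReal.ofReal_pow (norm_nonneg _), ENNReal.ofReal_pow (norm_nonneg _),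
        ofReal_norm, ofReal_norm]
    · obtain ⟨B, hB⟩ := H.decay 0 0
      have h1 := (H.integrable_pow_mul volume 2).mul_const B
      refine h1.mono' (by fun_prop) ?_
      filter_upwards with ξ
      have h2 := hB.2 ξ
      simp only [pow_zero, one_mul, norm_iteratedFDeriv_zero] at h2
      rw [Real.norm_eq_abs, abs_of_nonneg (by positivity), sq ‖H ξ‖, ← mul_assoc]
      exact mul_le_mul_of_nonneg_left h2 (by positivity)
    · filter_upwards with ξ
      positivity
  have hsob : sobolevNorm 1 (fun x => g x) = A ^ (1/2 : ℝ) := by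
    unfold sobolevNorm
    congr 1
    rw [hA]
    congr 1
    ext ξ
    rw [hH]
    congr 1
    norm_num
  have hfun : (fun p : ℝ × EuclideanSpace ℝ (Fin 3) =>
            ∫ ξ : EuclideanSpace ℝ (Fin 3),
              Complex.exp (Complex.I *
                Complex.ofReal (⟪p.2, ξ⟫ + sgn * (p.1 / ε) * pRot ξ)) *
                fourierTf (fun x => g x) ξ) = fun p => rsU (fun ξ => H ξ) ((sgn / ε) * p.1) p.2 := by
    ext p
    unfold rsU rsPh
    congr 1
    ext ξ
    rw [hH]
    congr 4
    ring
  rw [hfun, hsob]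
  have hUm := rsU_meas hHm
  have hUm2 : Measurable (fun p : ℝ × RS3 => rsU (fun ξ => H ξ) ((sgn / ε) * p.1) p.2) := by
    have h1 : Measurable (fun p : ℝ × RS3 => ((sgn / ε) * p.1, p.2)) := by fun_prop
    exact Measurable.comp (g := fun p : ℝ × RS3 => rsU (fun ξ => H ξ) p.1 p.2)
      (f := fun p : ℝ × RS3 => ((sgn / ε) * p.1, p.2)) hUm h1
  have hs0 : sgn ≠ 0 := by rcases hsgn with h | h <;> rw [h] <;> norm_num
  have hs1 : |(sgn / ε)⁻¹| = ε := by
    rcases hsgn with h | h <;> rw [h] <;> simp [abs_of_pos hε, abs_div]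
  have hInt : ∫⁻ p : ℝ × RS3, ‖rsU (fun ξ => H ξ) ((sgn / ε) * p.1) p.2‖ₑ ^ 6 ≤ ENNReal.ofReal (ε * (C * A ^ 3)) := by
    rw [Measure.volume_eq_prod, lintegral_prod _ (by fun_prop)]
    have := rs_lintegral_scale (fun t => ∫⁻ x, ‖rsU (fun ξ => H ξ) t x‖ₑ ^ 6) (c := sgn / ε) (div_ne_zero hs0 hε.ne')
      (Measurable.lintegral_prod_right (f := fun t x => ‖rsU (fun ξ => H ξ) t x‖ₑ ^ 6) (by
        simp only [Function.uncurry_def]; fun_prop))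
    simp only at this ⊢
    rw [this, hs1, ENNReal.ofReal_mul hε.le, ENNReal.ofReal_mul hC.le, ENNReal.ofReal_pow hA0, ← hAe]
    exact mul_le_mul' le_rfl hm
  rw [eLpNorm_eq_lintegral_rpow_enorm_toReal (by norm_num) (by norm_num)]
  have e6 : (6 : ℝ≥0∞).toReal = ((6:ℕ):ℝ) := by norm_num
  rw [e6]
  simp only [ENNReal.rpow_natCast]
  calc _ ≤ (ENNReal.ofReal (ε * (C * A ^ 3))) ^ (1 / ((6:ℕ):ℝ)) := by gcongr
    _ = ENNReal.ofReal ((ε * (C * A ^ 3)) ^ (1 / 6 : ℝ)) := by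
        rw [ENNReal.ofReal_rpow_of_nonneg (by positivity) (by norm_num)]
        norm_num
    _ = _ := by
        congr 1
        rw [Real.mul_rpow hε.le (by positivity), Real.mul_rpow hC.le (by positivity), ← Real.rpow_natCast A 3,
          ← Real.rpow_mul hA0]
        norm_num
        ring

end
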